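/- arXiv:1803.05433 — 7 statements merged into one kernel-verified Lean document; each statement's English description precedes it below -/
import Mathlib

section
/- Let μ be a p×p interval matrix with entries μ_{i,j} = [m_{i,j}, M_{i,j}] where m_{i,j} ≤ M_{i,j}. Let Y_p = {-1,1}^p and, for x ∈ Y_p, let T_x denote the p×p diagonal matrix whose diagonal is x; define C^μ_{x,y} = C^μ - T_x Δ^μ T_y for x, y ∈ Y_p. Then μ is a full-rank interval matrix if and only if, for every x, y, x', y' ∈ Y_p, det(C^μ_{x,y}) · det(C^μ_{x',y'}) > 0. -/
/-- The midpoint matrix `C^μ` of the interval matrix with left endpoints `m` and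
right endpoints `M`. -/
noncomputable def Cmat {p q : ℕ} (m M : Matrix (Fin p) (Fin q) ℝ) : Matrix (Fin p) (Fin q) ℝ :=
  Matrix.of fun i j => (m i j + M i j) / 2

/-- The radius matrix `Δ^μ` of the interval matrix with left endpoints `m` and
right endpoints `M`. -/
noncomputable def Dmat {p q : ℕ} (m M : Matrix (Fin p) (Fin q) ℝ) : Matrix (Fin p) (Fin q) ℝ :=
  Matrix.of fun i j => (M i j - m i j) / 2

/-- A square real matrix has full rank iff its determinant does not vanish. -/
theorem rank_eq_iff_det_ne_zero {p : ℕ} (A : Matrix (Fin p) (Fin p) ℝ) :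
    A.rank = p ↔ A.det ≠ 0 := by
  rw [← isUnit_iff_ne_zero, ← Matrix.isUnit_iff_isUnit_det]
  constructor
  · intro h
    rw [← Matrix.mulVec_surjective_iff_isUnit]
    have htop : LinearMap.range A.mulVecLin = ⊤ := by
      apply Submodule.eq_top_of_finrank_eq
      simpa [Matrix.rank] using h
    exact LinearMap.range_eq_top.mp htop
  · intro h
    simpa using Matrix.rank_of_isUnit A h

/-- `det (C - diagonal t * B)` is affine in each coordinate of `t`. -/
theorem det_sub_diagonal_mul_eq_affine {p : ℕ} (C B : Matrix (Fin p) (Fin p) ℝ)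
    (t : Fin p → ℝ) (i : Fin p) :
    (C - Matrix.diagonal t * B).det =
      (1 - t i) / 2 * (C - Matrix.diagonal (Function.update t i (-1)) * B).det +
      (1 + t i) / 2 * (C - Matrix.diagonal (Function.update t i 1) * B).det := by
  have key : ∀ s : ℝ, C - Matrix.diagonal (Function.update t i s) * B =
      (C - Matrix.diagonal t * B).updateRow i (C i - s • B i) := by
    intro s
    ext j k
    by_cases h : j = i
    · subst h
      simp [Matrix.diagonal_mul]
    · simp [Matrix.diagonal_mul, h]
  have hrow : C i - t i • B i =
      ((1 - t i) / 2) • (C i - (-1 : ℝ) • B i) + ((1 + t i) / 2) • (C i - (1 : ℝ) • B i) := by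
    ext k
    simp only [Pi.sub_apply, Pi.add_apply, Pi.smul_apply, smul_eq_mul]
    ring
  have h0 := key (t i)
  rw [Function.update_eq_self] at h0
  conv_lhs => rw [h0, hrow, Matrix.det_updateRow_add, Matrix.det_updateRow_smul,
    Matrix.det_updateRow_smul]
  rw [key, key]

/-- If `det (C - diagonal t * B) * d` is positive at all sign vectors `t`, it is positive on the
whole cube `[-1, 1]^p`. -/
theorem det_sub_diagonal_mul_pos_of_vertices {p : ℕ} (C B : Matrix (Fin p) (Fin p) ℝ) (d : ℝ)
    (h : ∀ t : Fin p → ℝ, (∀ i, t i = -1 ∨ t i = 1) →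
      0 < (C - Matrix.diagonal t * B).det * d)
    (t : Fin p → ℝ) (ht : ∀ i, |t i| ≤ 1) :
    0 < (C - Matrix.diagonal t * B).det * d := by
  have main : ∀ S : Finset (Fin p), ∀ t : Fin p → ℝ, (∀ i, |t i| ≤ 1) →
      (∀ i, i ∉ S → t i = -1 ∨ t i = 1) → 0 < (C - Matrix.diagonal t * B).det * d := by
    intro S
    induction S using Finset.induction_on with
    | empty => exact fun t _ hS => h t fun i => hS i (Finset.notMem_empty i)
    | insert a S _ ih =>
      intro t ht hS
      have step : ∀ s : ℝ, s = -1 ∨ s = 1 →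
          0 < (C - Matrix.diagonal (Function.update t a s) * B).det * d := by
        intro s hs
        apply ih
        · intro i
          by_cases hi : i = a
          · subst hi
            rcases hs with rfl | rfl <;> simp
          · simpa [hi] using ht i
        · intro i hiS
          by_cases hi : i = a
          · subst hi
            simpa using hs
          · simpa [hi] using hS i (by simp [hi, hiS])
      have h1 := step (-1) (Or.inl rfl)
      have h2 := step 1 (Or.inr rfl)
      obtain ⟨hl, hu⟩ := abs_le.mp (ht a)
      rw [det_sub_diagonal_mul_eq_affine C B t a]
      rcases hl.eq_or_lt with hl | hl
      · rw [← hl]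
        linarith
      · nlinarith [mul_pos (neg_lt_iff_pos_add.mp hl) h2,
          mul_nonneg (sub_nonneg.mpr hu) h1.le]
  exact main Finset.univ t ht fun i hi => absurd (Finset.mem_univ i) hi

/-- The vertex matrices `C - T_x Δ T_y` lie in the interval matrix. -/
theorem Cmat_sub_mem_Icc {p : ℕ} {m M : Matrix (Fin p) (Fin p) ℝ}
    (hmM : ∀ i j, m i j ≤ M i j) {x y : Fin p → ℝ}
    (hx : ∀ i, x i = -1 ∨ x i = 1) (hy : ∀ i, y i = -1 ∨ y i = 1) (i j : Fin p) :
    (Cmat m M - Matrix.diagonal x * Dmat m M * Matrix.diagonal y) i j ∈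
      Set.Icc (m i j) (M i j) := by
  have := hmM i j
  rw [Matrix.sub_apply, Matrix.mul_diagonal, Matrix.diagonal_mul]
  simp only [Cmat, Dmat, Matrix.of_apply, Set.mem_Icc]
  rcases hx i with h | h <;> rcases hy j with h' | h' <;> rw [h, h'] <;>
    constructor <;> linarith

/-- If `A v = 0` for some `A` in the interval matrix, then `|C v| ≤ Δ |v|`. -/
theorem abs_Cmat_mulVec_le {p : ℕ} {m M A : Matrix (Fin p) (Fin p) ℝ}
    (hA : ∀ i j, A i j ∈ Set.Icc (m i j) (M i j)) {v : Fin p → ℝ} (hv : A.mulVec v = 0)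
    (i : Fin p) : |(Cmat m M).mulVec v i| ≤ (Dmat m M).mulVec (fun j => |v j|) i := by
  have h : (Cmat m M).mulVec v i = (Cmat m M - A).mulVec v i := by
    rw [Matrix.sub_mulVec, hv, sub_zero]
  rw [h]
  simp only [Matrix.mulVec, dotProduct]
  refine (Finset.abs_sum_le_sum_abs _ _).trans (Finset.sum_le_sum fun j _ => ?_)
  rw [abs_mul]
  refine mul_le_mul_of_nonneg_right ?_ (abs_nonneg _)
  obtain ⟨hl, hu⟩ := hA i j
  simp only [Cmat, Dmat, Matrix.sub_apply, Matrix.of_apply]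
  rw [abs_le]
  constructor <;> linarith

/-- A real number of absolute value at most `b` is `t * b` with `|t| ≤ 1`. -/
theorem exists_abs_le_one_eq_mul {a b : ℝ} (h : |a| ≤ b) : ∃ t : ℝ, |t| ≤ 1 ∧ a = t * b := by
  rcases ((abs_nonneg a).trans h).eq_or_lt with hb | hb
  · refine ⟨0, by simp, ?_⟩
    rw [← hb] at h
    simpa using h
  · refine ⟨a / b, ?_, by field_simp⟩
    rw [abs_div, abs_of_pos hb]
    exact (div_le_one hb).mpr h

/-- If all matrices of a box are nonsingular, their determinants have the same sign. -/
theorem det_mul_det_pos_of_forall_det_ne_zero {p : ℕ} {m M A B : Matrix (Fin p) (Fin p) ℝ}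
    (h : ∀ A : Matrix (Fin p) (Fin p) ℝ, (∀ i j, A i j ∈ Set.Icc (m i j) (M i j)) → A.det ≠ 0)
    (hA : ∀ i j, A i j ∈ Set.Icc (m i j) (M i j)) (hB : ∀ i j, B i j ∈ Set.Icc (m i j) (M i j)) :
    0 < A.det * B.det := by
  have hcont : Continuous fun s : ℝ => ((1 - s) • A + s • B).det * B.det := by
    fun_prop
  by_contra! hneg
  have h01 : (0 : ℝ) ∈ Set.Icc (((1 - (0 : ℝ)) • A + (0 : ℝ) • B).det * B.det)
      (((1 - (1 : ℝ)) • A + (1 : ℝ) • B).det * B.det) := by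
    simpa using ⟨hneg, mul_self_nonneg B.det⟩
  obtain ⟨s, ⟨hs0, hs1⟩, hs⟩ :=
    intermediate_value_Icc (zero_le_one' ℝ) hcont.continuousOn h01
  refine mul_ne_zero (h _ fun i j => ?_) (h B hB) hs
  exact convex_Icc (m i j) (M i j) (hA i j) (hB i j) (sub_nonneg.mpr hs1) hs0 (by ring)

/-- **Rohn's theorem.** A `p × p` interval matrix `μ = ([m i j, M i j])_{i,j}` is full-rank
(every contained real matrix has rank `p`) iff for all sign vectors
`x, y, x', y' ∈ {-1,1}^p` we have `det (C^μ - T_x Δ^μ T_y) · det (C^μ - T_{x'} Δ^μ T_{y'}) > 0`. -/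
theorem rohn_square_interval_full_rank (p : ℕ) (m M : Matrix (Fin p) (Fin p) ℝ)
    (hmM : ∀ i j, m i j ≤ M i j) :
    (∀ A : Matrix (Fin p) (Fin p) ℝ,
        (∀ i j, A i j ∈ Set.Icc (m i j) (M i j)) → A.rank = p) ↔
    (∀ x y x' y' : Fin p → ℝ,
        (∀ i, x i = -1 ∨ x i = 1) → (∀ i, y i = -1 ∨ y i = 1) →
        (∀ i, x' i = -1 ∨ x' i = 1) → (∀ i, y' i = -1 ∨ y' i = 1) →
        0 < (Cmat m M - Matrix.diagonal x * Dmat m M * Matrix.diagonal y).det *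
            (Cmat m M - Matrix.diagonal x' * Dmat m M * Matrix.diagonal y').det) := by
  simp only [rank_eq_iff_det_ne_zero]
  constructor
  · intro h x y x' y' hx hy hx' hy'
    exact det_mul_det_pos_of_forall_det_ne_zero h (Cmat_sub_mem_Icc hmM hx hy)
      (Cmat_sub_mem_Icc hmM hx' hy')
  · intro h A hA hdet
    obtain ⟨v, hv0, hv⟩ := Matrix.exists_mulVec_eq_zero_iff.mpr hdet
    choose t ht htv using fun i => exists_abs_le_one_eq_mul (abs_Cmat_mulVec_le hA hv i)
    let y : Fin p → ℝ := fun j => if v j < 0 then -1 else 1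
    have hy : ∀ j, y j = -1 ∨ y j = 1 := fun j => by
      by_cases hj : v j < 0 <;> simp [y, hj]
    have hyv : (Matrix.diagonal y).mulVec v = fun j => |v j| := by
      ext j
      rw [Matrix.mulVec_diagonal]
      by_cases hj : v j < 0
      · simp [y, hj, abs_of_neg hj]
      · simp [y, hj, abs_of_nonneg (not_lt.mp hj)]
    have hpos := det_sub_diagonal_mul_pos_of_vertices (Cmat m M)
      (Dmat m M * Matrix.diagonal y) _ (fun x hx => by
        rw [← Matrix.mul_assoc]
        exact h x y (fun _ => 1) (fun _ => 1) hx hy (fun _ => Or.inr rfl) fun _ => Or.inr rfl) t ht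
    have hzero : (Cmat m M - Matrix.diagonal t * (Dmat m M * Matrix.diagonal y)).det = 0 := by
      refine Matrix.exists_mulVec_eq_zero_iff.mp ⟨v, hv0, ?_⟩
      ext i
      rw [Matrix.sub_mulVec, ← Matrix.mulVec_mulVec, ← Matrix.mulVec_mulVec, hyv, Pi.sub_apply,
        Matrix.mulVec_diagonal, htv i, sub_self, Pi.zero_apply]
    rw [hzero, zero_mul] at hpos
    exact hpos.false
end

section
/- Let μ be a p×q interval matrix with p ≥ q. Then μ has full rank (i.e., every real matrix contained in μ has rank q) if and only if the system of inequalities |C^μ x| ≤ Δ^μ |x|, for x ∈ ℝ^q (where the absolute values and the inequality are taken componentwise), has only the trivial solution x = 0. -/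
/-- A real matrix has rank equal to its number of columns iff its kernel is trivial. -/
theorem Matrix.rank_eq_card_cols_iff {p q : ℕ} (A : Matrix (Fin p) (Fin q) ℝ) :
    A.rank = q ↔ ∀ x, A.mulVec x = 0 → x = 0 := by
  have h : LinearIndependent ℝ A.col ↔ A.rank = q := by
    rw [linearIndependent_iff_card_eq_finrank_span, Set.finrank,
      ← Matrix.rank_eq_finrank_span_cols, Fintype.card_fin, eq_comm]
  rw [← h, ← Matrix.mulVec_injective_iff]
  exact injective_iff_map_eq_zero (Matrix.mulVecLin A)

/-- **Rohn's theorem, rectangular case.** A `p × q` interval matrix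
`μ = ([m i j, M i j])_{i,j}` with `p ≥ q` has full rank (every contained real matrix has
rank `q`) iff the system of inequalities `|C^μ x| ≤ Δ^μ |x|` (componentwise) has only the
trivial solution `x = 0`. -/
theorem rohn_rectangular_interval_full_rank (p q : ℕ) (hpq : p ≥ q)
    (m M : Matrix (Fin p) (Fin q) ℝ) (hmM : ∀ i j, m i j ≤ M i j) :
    (∀ A : Matrix (Fin p) (Fin q) ℝ,
        (∀ i j, A i j ∈ Set.Icc (m i j) (M i j)) → A.rank = q) ↔
    (∀ x : Fin q → ℝ,
        (∀ i, |(Cmat m M).mulVec x i| ≤ (Dmat m M).mulVec (fun j => |x j|) i) → x = 0) := by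
  constructor
  · intro h x hx
    set d := (Dmat m M).mulVec fun j => |x j| with hd
    set c := (Cmat m M).mulVec x with hc
    have hcd : ∀ i, c i / d i * d i = c i := fun i => div_mul_cancel_of_imp fun h0 => by
      have := hx i
      rw [h0] at this
      exact abs_nonpos_iff.mp this
    have ht : ∀ i, |c i / d i| ≤ 1 := fun i => by
      rw [abs_div]
      exact div_le_one_of_le₀ ((hx i).trans (le_abs_self _)) (abs_nonneg _)
    let A : Matrix (Fin p) (Fin q) ℝ := Matrix.of fun i j =>
      Cmat m M i j - c i / d i * (SignType.sign (x j) : ℝ) * Dmat m M i j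
    refine (Matrix.rank_eq_card_cols_iff A).mp (h A fun i j => ?_) x (funext fun i => ?_)
    · have hs : |(SignType.sign (x j) : ℝ)| ≤ 1 := by
        rcases lt_trichotomy (x j) 0 with hj | hj | hj <;> simp [hj]
      have hts : |c i / d i * (SignType.sign (x j) : ℝ)| ≤ 1 := by
        rw [abs_mul]
        exact mul_le_one₀ (ht i) (abs_nonneg _) hs
      obtain ⟨h₁, h₂⟩ := abs_le.mp hts
      have hm := hmM i j
      simp only [A, Matrix.of_apply, Cmat, Dmat, Set.mem_Icc]
      constructor <;> nlinarith
    · calc A.mulVec x i = c i - c i / d i * d i := by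
            simp only [A, hc, hd, Matrix.mulVec, dotProduct, Matrix.of_apply]
            rw [Finset.mul_sum, ← Finset.sum_sub_distrib]
            refine Finset.sum_congr rfl fun j _ => ?_
            rw [← sign_mul_self (x j)]
            ring
        _ = 0 := by rw [hcd, sub_self]
  · intro h A hA
    refine (Matrix.rank_eq_card_cols_iff A).mpr fun x hx => h x fun i => ?_
    have hCA : (Cmat m M).mulVec x i = ∑ j, (Cmat m M i j - A i j) * x j := by
      have := congrFun hx i
      simp only [Matrix.mulVec, dotProduct, Pi.zero_apply] at this ⊢
      simp [sub_mul, this]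
    rw [hCA]
    refine (Finset.abs_sum_le_sum_abs _ _).trans (Finset.sum_le_sum fun j _ => ?_)
    rw [abs_mul]
    refine mul_le_mul_of_nonneg_right ?_ (abs_nonneg _)
    obtain ⟨h₁, h₂⟩ := hA i j
    simp only [Cmat, Dmat, Matrix.of_apply]
    exact abs_le.mpr ⟨by linarith, by linarith⟩
end

section
/- Let μ be a p×q interval matrix. Then the rank range of μ is the full set of integers between the minimal rank and the maximal rank: rkRange(μ) = [mrk(μ), Mrk(μ)] ∩ ℕ. In other words, for every natural number t with mrk(μ) ≤ t ≤ Mrk(μ), there exists a real matrix A ∈ μ with rank(A) = t. -/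
/-- The set of ranks of real matrices contained in the interval matrix with left endpoints
`m` and right endpoints `M` (the rank range `rkRange(μ)`). -/
def rkRange {p q : ℕ} (m M : Matrix (Fin p) (Fin q) ℝ) : Set ℕ :=
  {t : ℕ | ∃ A : Matrix (Fin p) (Fin q) ℝ,
    (∀ i j, A i j ∈ Set.Icc (m i j) (M i j)) ∧ A.rank = t}

/-- A discrete intermediate value theorem for sequences that increase by at most one. -/
lemma exists_le_eq_of_succ_le_add_one {f : ℕ → ℕ} {n t : ℕ} (h0 : f 0 ≤ t) (hn : t ≤ f n)
    (hf : ∀ k < n, f (k + 1) ≤ f k + 1) : ∃ k ≤ n, f k = t := by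
  induction n with
  | zero => exact ⟨0, le_rfl, le_antisymm h0 hn⟩
  | succ n ih =>
    by_cases h : t ≤ f n
    · obtain ⟨k, hk, rfl⟩ := ih h fun k hk => hf k (by omega)
      exact ⟨k, by omega, rfl⟩
    · have := hf n (by omega)
      exact ⟨n + 1, le_rfl, by omega⟩

lemma Matrix.rank_add_le_rank_add_rank {m n K : Type*} [Finite m] [Fintype n] [Field K]
    (A B : Matrix m n K) : (A + B).rank ≤ A.rank + B.rank := by
  rw [Matrix.rank, Matrix.mulVecLin_add]
  exact (Submodule.finrank_mono (LinearMap.range_add_le _ _)).trans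
    (Submodule.finrank_add_le_finrank_add_finrank _ _)

lemma Matrix.rank_updateCol_le {m n K : Type*} [Finite m] [Fintype n] [DecidableEq n] [Field K]
    (A : Matrix m n K) (j : n) (v : m → K) : (A.updateCol j v).rank ≤ A.rank + 1 := by
  have h : A.updateCol j v = A + Matrix.vecMulVec (v - A.col j) (Pi.single j 1) := by
    ext i k
    by_cases hk : k = j
    · subst hk
      simp [Matrix.vecMulVec_apply]
    · simp [Matrix.vecMulVec_apply, hk]
  rw [h]
  exact (Matrix.rank_add_le_rank_add_rank _ _).trans
    (Nat.add_le_add_left (Matrix.rank_vecMulVec_le _ _) _)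

/-- Replacing the columns of `A` by those of `B` one at a time realizes every intermediate rank. -/
lemma Matrix.exists_rank_eq_of_rank_le_of_le_rank {p q : ℕ} {K : Type*} [Field K]
    (A B : Matrix (Fin p) (Fin q) K) {t : ℕ} (hA : A.rank ≤ t) (hB : t ≤ B.rank) :
    ∃ C : Matrix (Fin p) (Fin q) K, (∀ i j, C i j = A i j ∨ C i j = B i j) ∧ C.rank = t := by
  let C : ℕ → Matrix (Fin p) (Fin q) K :=
    fun k => Matrix.of fun i j => if (j : ℕ) < k then B i j else A i j
  have hC0 : C 0 = A := by ext; simp [C]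
  have hCq : C q = B := by ext; simp [C]
  have hstep : ∀ k < q, (C (k + 1)).rank ≤ (C k).rank + 1 := by
    intro k hk
    have h : C (k + 1) = (C k).updateCol ⟨k, hk⟩ (B.col ⟨k, hk⟩) := by
      ext i j
      by_cases hj : j = ⟨k, hk⟩
      · subst hj
        simp [C]
      · have hjk : (j : ℕ) ≠ k := fun h => hj (Fin.ext h)
        have hlt : (j : ℕ) < k + 1 ↔ (j : ℕ) < k := by omega
        simp [C, hj, hlt]
    rw [h]
    exact Matrix.rank_updateCol_le _ _ _
  obtain ⟨k, -, hk⟩ := exists_le_eq_of_succ_le_add_one (f := fun k => (C k).rank)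
    (hC0.symm ▸ hA) (hCq.symm ▸ hB) hstep
  refine ⟨C k, fun i j => ?_, hk⟩
  by_cases h : (j : ℕ) < k <;> simp [C, h]

/-- The rank range of an interval matrix is the full integer interval between the minimal
rank `mrk(μ) = sInf (rkRange μ)` and the maximal rank `Mrk(μ) = sSup (rkRange μ)`:
for every natural number `t` with `mrk(μ) ≤ t ≤ Mrk(μ)` there is a matrix `A ∈ μ` with
`rank A = t`. -/
theorem rkRange_eq_Icc (p q : ℕ) (m M : Matrix (Fin p) (Fin q) ℝ)
    (hmM : ∀ i j, m i j ≤ M i j) :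
    rkRange m M = Set.Icc (sInf (rkRange m M)) (sSup (rkRange m M)) := by
  have hne : (rkRange m M).Nonempty := ⟨m.rank, m, fun i j => ⟨le_rfl, hmM i j⟩, rfl⟩
  have hbdd : BddAbove (rkRange m M) := by
    refine ⟨q, ?_⟩
    rintro _ ⟨A, -, rfl⟩
    exact A.rank_le_width
  apply Set.Subset.antisymm
  · exact fun t ht => ⟨Nat.sInf_le ht, le_csSup hbdd ht⟩
  · rintro t ⟨hlo, hhi⟩
    obtain ⟨A, hA, hAr⟩ := Nat.sInf_mem hne
    obtain ⟨B, hB, hBr⟩ := Nat.sSup_mem hne hbdd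
    obtain ⟨C, hC, hCr⟩ :=
      A.exists_rank_eq_of_rank_le_of_le_rank B (hAr.trans_le hlo) (hhi.trans_eq hBr.symm)
    refine ⟨C, fun i j => ?_, hCr⟩
    rcases hC i j with h | h
    · exact h ▸ hA i j
    · exact h ▸ hB i j
end

section
/- Let μ be a p×p general closed interval matrix. Then Mrk(μ) < p if and only if the following two conditions hold: (1) in μ there is no totally nonconstant partial generalized diagonal of length p; (2) the complementary matrix of every totally nonconstant partial generalized diagonal of μ of length between 0 and p−1 has det^c equal to 0. -/
open scoped Classical

/-- A real matrix `A` is contained in the (general closed interval) matrix `μ` of subsets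
of `ℝ` iff each entry of `A` belongs to the corresponding entry of `μ`. -/
def Contains {I J : Type*} (μ : Matrix I J (Set ℝ)) (A : Matrix I J ℝ) : Prop :=
  ∀ i j, A i j ∈ μ i j

/-- `μ` is a general closed interval matrix: every entry is a closed connected nonempty
subset of `ℝ`. -/
def GCIM {I J : Type*} (μ : Matrix I J (Set ℝ)) : Prop :=
  ∀ i j, IsClosed (μ i j) ∧ (μ i j).Nonempty ∧ IsPreconnected (μ i j)

/-- An entry is constant iff it is a singleton. -/
def IsConst (S : Set ℝ) : Prop := ∃ a : ℝ, S = {a}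

/-- The maximal rank `Mrk(μ)` of a general closed interval matrix. -/
noncomputable def Mrk {I J : Type*} [Fintype I] [Fintype J] (μ : Matrix I J (Set ℝ)) : ℕ :=
  sSup {t : ℕ | ∃ A : Matrix I J ℝ, Contains μ A ∧ A.rank = t}

/-- `det^c` of a square matrix of subsets of `ℝ`: the sum over all (generalized)
permutations all of whose selected entries are constant, of the sign of the permutation
times the product of the constants (a singleton `{a}` has `sSup {a} = a`).  Rows and
columns are identified with `Fin n` via the unique monotone bijections, so that for
matrices indexed by `Fin n`, or for complementary submatrices, the sign is the usual one. -/
noncomputable def detc {I J : Type*} [Fintype I] [Fintype J] [LinearOrder I] [LinearOrder J]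
    (ν : Matrix I J (Set ℝ)) : ℝ :=
  ∑ e : I ≃ J,
    if ∀ i, IsConst (ν i (e i)) then
      ((Equiv.Perm.sign ((monoEquivOfFin I rfl).toEquiv.trans
        (e.trans (monoEquivOfFin J (Fintype.card_congr e.symm)).toEquiv.symm)) : ℤ) : ℝ) *
      ∏ i, sSup (ν i (e i))
    else 0

namespace IntervalMatrix

/-- The value of a constant entry, and `0` for a nonconstant one. -/
noncomputable def constPart (S : Set ℝ) : ℝ := if IsConst S then sSup S else 0

theorem prod_constPart {I J : Type*} [Fintype I] (ν : Matrix I J (Set ℝ)) (f : I → J) :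
    ∏ i, constPart (ν i (f i)) =
      if ∀ i, IsConst (ν i (f i)) then ∏ i, sSup (ν i (f i)) else 0 := by
  split_ifs with h
  · exact Finset.prod_congr rfl fun i _ => if_pos (h i)
  · push Not at h
    obtain ⟨i, hi⟩ := h
    exact Finset.prod_eq_zero (Finset.mem_univ i) (if_neg hi)

theorem detc_eq_det {I J : Type*} [Fintype I] [Fintype J] [LinearOrder I] [LinearOrder J]
    (ν : Matrix I J (Set ℝ)) (h : Fintype.card J = Fintype.card I) :
    detc ν = (Matrix.of fun a b : Fin (Fintype.card I) =>
      constPart (ν (monoEquivOfFin I rfl a) (monoEquivOfFin J h b))).det := by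
  rw [← Matrix.det_transpose, Matrix.det_apply', detc]
  refine Fintype.sum_equiv
    (Equiv.equivCongr (monoEquivOfFin I rfl).toEquiv.symm (monoEquivOfFin J h).toEquiv.symm)
    _ _ fun e => ?_
  have hprod : ∏ i, constPart (ν i (e i)) = ∏ a, constPart (ν (monoEquivOfFin I rfl a)
      (e (monoEquivOfFin I rfl a))) :=
    (Fintype.prod_equiv (monoEquivOfFin I rfl).toEquiv _ _ fun a => rfl).symm
  rw [← mul_ite_zero, ← prod_constPart, hprod]
  congr 1
  simp [Equiv.equivCongr]

/-- An injective family together with the complement of its range enumerates everything. -/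
noncomputable def sumComplEquiv {K P : Type*} (r : K → P) (hr : Function.Injective r) :
    K ⊕ {i : P // ∀ t, r t ≠ i} ≃ P :=
  Equiv.ofBijective (Sum.elim r Subtype.val) <| by
    refine ⟨hr.sumElim Subtype.val_injective fun t i => i.2 t, fun i => ?_⟩
    by_cases h : ∃ t, r t = i
    · exact ⟨Sum.inl h.choose, h.choose_spec⟩
    · exact ⟨Sum.inr ⟨i, not_exists.1 h⟩, rfl⟩

@[simp]
theorem sumComplEquiv_inl {K P : Type*} (r : K → P) (hr : Function.Injective r) (t : K) :
    sumComplEquiv r hr (Sum.inl t) = r t := rfl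

@[simp]
theorem sumComplEquiv_inr {K P : Type*} (r : K → P) (hr : Function.Injective r)
    (i : {i : P // ∀ t, r t ≠ i}) : sumComplEquiv r hr (Sum.inr i) = i := rfl

/-- The constant part of `μ`, with row `r t` replaced by the unit vector at `c t`. -/
noncomputable def pinned {k p : ℕ} (μ : Matrix (Fin p) (Fin p) (Set ℝ)) (r c : Fin k → Fin p) :
    Matrix (Fin p) (Fin p) ℝ :=
  Matrix.of fun i j => if ∃ t, r t = i then (if ∃ t, r t = i ∧ c t = j then 1 else 0)
    else constPart (μ i j)

theorem abs_detc_compl {k p : ℕ} (μ : Matrix (Fin p) (Fin p) (Set ℝ)) (r c : Fin k → Fin p)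
    (hr : Function.Injective r) (hc : Function.Injective c) :
    |detc (Matrix.of fun (i : {i : Fin p // ∀ t, r t ≠ i})
      (j : {j : Fin p // ∀ t, c t ≠ j}) => μ i.1 j.1)| = |(pinned μ r c).det| := by
  have h : Fintype.card {j : Fin p // ∀ t, c t ≠ j} = Fintype.card {i : Fin p // ∀ t, r t ≠ i} := by
    have h1 := Fintype.card_congr (sumComplEquiv r hr)
    have h2 := Fintype.card_congr (sumComplEquiv c hc)
    rw [Fintype.card_sum] at h1 h2
    omega
  rw [detc_eq_det _ h, ← Matrix.abs_det_submatrix_equiv_equiv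
    ((Equiv.sumCongr (Equiv.refl _) (monoEquivOfFin _ rfl).toEquiv).trans (sumComplEquiv r hr))
    ((Equiv.sumCongr (Equiv.refl _) (monoEquivOfFin _ h).toEquiv).trans (sumComplEquiv c hc))
    (pinned μ r c)]
  congr 1
  rw [← Matrix.fromBlocks_toBlocks (Matrix.submatrix _ _ _)]
  have h11 : (Matrix.submatrix (pinned μ r c)
      ((Equiv.sumCongr (Equiv.refl _) (monoEquivOfFin _ rfl).toEquiv).trans (sumComplEquiv r hr))
      ((Equiv.sumCongr (Equiv.refl _) (monoEquivOfFin _ h).toEquiv).trans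
        (sumComplEquiv c hc))).toBlocks₁₁ = 1 := by
    ext s t
    simp [Matrix.toBlocks₁₁, pinned, hr.eq_iff, hc.eq_iff, Matrix.one_apply,
      eq_comm]
  have h12 : (Matrix.submatrix (pinned μ r c)
      ((Equiv.sumCongr (Equiv.refl _) (monoEquivOfFin _ rfl).toEquiv).trans (sumComplEquiv r hr))
      ((Equiv.sumCongr (Equiv.refl _) (monoEquivOfFin _ h).toEquiv).trans
        (sumComplEquiv c hc))).toBlocks₁₂ = 0 := by
    ext s t
    have ht : ∀ u, c u ≠ _ := (monoEquivOfFin {j : Fin p // ∀ t, c t ≠ j} h t).2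
    simp [Matrix.toBlocks₁₂, pinned, hr.eq_iff, ht]
  rw [h11, h12, Matrix.det_fromBlocks_zero₁₂, Matrix.det_one, one_mul]
  congr 1
  ext s t
  have hs : ∀ u, r u ≠ _ := (monoEquivOfFin {i : Fin p // ∀ t, r t ≠ i} rfl s).2
  simp [Matrix.toBlocks₂₂, pinned, hs]

/-- The matrix with the constants of `μ` and an indeterminate at each nonconstant entry. -/
noncomputable def generic {p : ℕ} (μ : Matrix (Fin p) (Fin p) (Set ℝ)) :
    Matrix (Fin p) (Fin p) (MvPolynomial (Fin p × Fin p) ℝ) :=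
  Matrix.of fun i j => if IsConst (μ i j) then MvPolynomial.C (sSup (μ i j))
    else MvPolynomial.X (i, j)

theorem eval_det_generic {p : ℕ} (μ : Matrix (Fin p) (Fin p) (Set ℝ))
    (x : Fin p × Fin p → ℝ) :
    MvPolynomial.eval x (generic μ).det =
      (Matrix.of fun i j => if IsConst (μ i j) then sSup (μ i j) else x (i, j)).det := by
  rw [RingHom.map_det]
  congr 1
  ext i j
  simp only [generic, RingHom.mapMatrix_apply, Matrix.map_apply, Matrix.of_apply]
  split_ifs <;> simp

theorem det_generic_eq_zero_iff {p : ℕ} (μ : Matrix (Fin p) (Fin p) (Set ℝ)) (hμ : GCIM μ) :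
    (generic μ).det = 0 ↔ ∀ A, Contains μ A → A.det = 0 := by
  constructor
  · intro h A hA
    have := eval_det_generic μ fun q => A q.1 q.2
    rw [h, map_zero] at this
    rw [this]
    congr 1
    ext i j
    simp only [Matrix.of_apply]
    split_ifs with hc
    · obtain ⟨a, ha⟩ := hc
      have := hA i j
      rw [ha] at this ⊢
      simpa using this
    · rfl
  · intro h
    refine MvPolynomial.funext_set
      (fun q => if IsConst (μ q.1 q.2) then Set.univ else μ q.1 q.2) (fun q => ?_) fun x hx => ?_
    · split_ifs with hc
      · exact Set.infinite_univ
      · obtain ⟨-, hne, hpre⟩ := hμ q.1 q.2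
        refine hpre.infinite_of_nontrivial (Set.not_subsingleton_iff.1 fun hs => hc ?_)
        exact Set.exists_eq_singleton_iff_nonempty_subsingleton.2 ⟨hne, hs⟩
    · rw [eval_det_generic, map_zero]
      refine h _ fun i j => ?_
      have hx := hx (i, j) (Set.mem_univ _)
      simp only [Matrix.of_apply]
      split_ifs with hc
      · obtain ⟨a, ha⟩ := hc
        simp [ha]
      · simpa only [if_neg hc] using hx

/-- The squarefree exponent supported on the positions satisfying `Q`. -/
noncomputable def squarefreeExp {α : Type*} [Finite α] (Q : α → Prop) : α →₀ ℕ :=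
  Finsupp.equivFunOnFinite.symm fun x => if Q x then 1 else 0

theorem squarefreeExp_eq_iff {α : Type*} [Finite α] (Q R : α → Prop) :
    squarefreeExp Q = squarefreeExp R ↔ ∀ x, Q x ↔ R x := by
  rw [squarefreeExp, squarefreeExp, Equiv.apply_eq_iff_eq, funext_iff]
  refine forall_congr' fun x => ?_
  by_cases h1 : Q x <;> by_cases h2 : R x <;> simp [h1, h2]

theorem prod_generic {p : ℕ} (μ : Matrix (Fin p) (Fin p) (Set ℝ)) (σ : Equiv.Perm (Fin p)) :
    ∏ i, generic μ i (σ i) =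
      MvPolynomial.monomial (squarefreeExp fun q => σ q.1 = q.2 ∧ ¬ IsConst (μ q.1 q.2))
        (∏ i, if IsConst (μ i (σ i)) then sSup (μ i (σ i)) else 1) := by
  have h : (squarefreeExp fun q : Fin p × Fin p => σ q.1 = q.2 ∧ ¬ IsConst (μ q.1 q.2)) =
      ∑ i, if IsConst (μ i (σ i)) then 0 else Finsupp.single (i, σ i) 1 := by
    ext ⟨i, j⟩
    rw [Finsupp.finsetSum_apply, Finset.sum_eq_single i]
    · by_cases hj : σ i = j
      · subst hj
        by_cases hc : IsConst (μ i (σ i)) <;> simp [squarefreeExp, hc]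
      · by_cases hc : IsConst (μ i (σ i)) <;> simp [squarefreeExp, hc, hj]
    · intro b _ hb
      split_ifs <;> simp [hb]
    · simp
  rw [h, MvPolynomial.monomial_sum_prod]
  refine Finset.prod_congr rfl fun i _ => ?_
  simp only [generic, Matrix.of_apply]
  split_ifs <;> rfl

theorem coeff_det_generic {p : ℕ} (μ : Matrix (Fin p) (Fin p) (Set ℝ))
    (m : Fin p × Fin p →₀ ℕ) :
    MvPolynomial.coeff m (generic μ).det = ∑ σ : Equiv.Perm (Fin p),
      ((Equiv.Perm.sign σ : ℤ) : ℝ) *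
        if (squarefreeExp fun q => σ q.1 = q.2 ∧ ¬ IsConst (μ q.1 q.2)) = m then
          ∏ i, (if IsConst (μ i (σ i)) then sSup (μ i (σ i)) else 1) else 0 := by
  rw [← Matrix.det_transpose, Matrix.det_apply', MvPolynomial.coeff_sum]
  refine Finset.sum_congr rfl fun σ _ => ?_
  simp only [Matrix.transpose_apply]
  rw [prod_generic, ← map_intCast (MvPolynomial.C (R := ℝ) (σ := Fin p × Fin p)),
    MvPolynomial.coeff_C_mul, MvPolynomial.coeff_monomial]

theorem coeff_det_generic_eq_det_pinned {k p : ℕ} (μ : Matrix (Fin p) (Fin p) (Set ℝ))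
    (r c : Fin k → Fin p) (hr : Function.Injective r)
    (hrc : ∀ t, ¬ IsConst (μ (r t) (c t))) :
    MvPolynomial.coeff (squarefreeExp fun q => ∃ t, r t = q.1 ∧ c t = q.2) (generic μ).det =
      (pinned μ r c).det := by
  rw [coeff_det_generic, ← Matrix.det_transpose, Matrix.det_apply']
  refine Finset.sum_congr rfl fun σ _ => ?_
  congr 1
  simp only [Matrix.transpose_apply, squarefreeExp_eq_iff, Prod.forall]
  split_ifs with h
  · refine Finset.prod_congr rfl fun i _ => ?_
    have hi := h i (σ i)
    simp only [pinned, Matrix.of_apply, constPart]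
    by_cases hc : IsConst (μ i (σ i))
    · rw [if_neg (c := ∃ t, r t = i), if_pos hc, if_pos hc]
      rintro ⟨t, rfl⟩
      have h2 := ((h (r t) (c t)).2 ⟨t, rfl, rfl⟩).1
      rw [h2] at hc
      exact hrc t hc
    · obtain ⟨t, ht⟩ := hi.1 ⟨rfl, hc⟩
      rw [if_neg hc, if_pos ⟨t, ht.1⟩, if_pos ⟨t, ht⟩]
  · contrapose! h
    have h := fun i => Finset.prod_ne_zero_iff.1 h.symm i (Finset.mem_univ i)
    simp only [pinned, Matrix.of_apply, constPart] at h
    intro i j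
    constructor
    · rintro ⟨rfl, hc⟩
      have := h i
      rw [if_neg hc] at this
      exact (ite_ne_right_iff.1 (ite_ne_right_iff.1 this).2).1
    · rintro ⟨t, rfl, rfl⟩
      refine ⟨?_, hrc t⟩
      have := h (r t)
      rw [if_pos ⟨t, rfl⟩] at this
      obtain ⟨s, hs, hs'⟩ := (ite_ne_right_iff.1 this).1
      rw [← hs', hr hs]

theorem det_generic_eq_zero_iff_pinned {p : ℕ} (μ : Matrix (Fin p) (Fin p) (Set ℝ)) :
    (generic μ).det = 0 ↔ ∀ k : ℕ, k ≤ p → ∀ r c : Fin k → Fin p,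
      Function.Injective r → Function.Injective c → (∀ t, ¬ IsConst (μ (r t) (c t))) →
        (pinned μ r c).det = 0 := by
  constructor
  · intro h k _ r c hr _ hrc
    rw [← coeff_det_generic_eq_det_pinned μ r c hr hrc, h, MvPolynomial.coeff_zero]
  · intro h
    ext m
    rw [MvPolynomial.coeff_zero]
    by_cases hm : ∃ σ : Equiv.Perm (Fin p),
        (squarefreeExp fun q : Fin p × Fin p => σ q.1 = q.2 ∧ ¬ IsConst (μ q.1 q.2)) = m
    · obtain ⟨σ, rfl⟩ := hm
      let s : Finset (Fin p) := Finset.univ.filter fun i => ¬ IsConst (μ i (σ i))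
      let r := s.orderEmbOfFin rfl
      have hmem : ∀ i, ¬ IsConst (μ i (σ i)) ↔ ∃ t, r t = i := fun i => by
        have : i ∈ Set.range r ↔ i ∈ s := by
          rw [Finset.range_orderEmbOfFin, Finset.mem_coe]
        simpa [s] using this.symm
      have hrc : ∀ t, ¬ IsConst (μ (r t) (σ (r t))) := fun t => (hmem _).2 ⟨t, rfl⟩
      have key := coeff_det_generic_eq_det_pinned μ r (σ ∘ r) r.injective hrc
      rw [h _ (card_finset_fin_le s) _ _ r.injective (σ.injective.comp r.injective) hrc] at key
      rw [← key]
      congr 1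
      rw [squarefreeExp_eq_iff]
      simp only [Function.comp_apply]
      grind
    · rw [coeff_det_generic]
      refine Finset.sum_eq_zero fun σ _ => ?_
      rw [if_neg fun h => hm ⟨σ, h⟩, mul_zero]

theorem Mrk_lt_iff_det {p : ℕ} (μ : Matrix (Fin p) (Fin p) (Set ℝ)) (hμ : GCIM μ) :
    Mrk μ < p ↔ ∀ A, Contains μ A → A.det = 0 := by
  have hle : ∀ t ∈ {t : ℕ | ∃ A : Matrix (Fin p) (Fin p) ℝ, Contains μ A ∧ A.rank = t}, t ≤ p := by
    rintro t ⟨A, -, rfl⟩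
    simpa using A.rank_le_card_width
  constructor
  · intro h A hA
    by_contra hdet
    have hrank : A.rank = p := by
      simpa using Matrix.rank_of_isUnit A ((Matrix.isUnit_iff_isUnit_det A).2 (Ne.isUnit hdet))
    exact h.not_ge (le_csSup ⟨p, hle⟩ ⟨A, hA, hrank⟩)
  · intro h
    choose A hA using fun i j => (hμ i j).2.1
    obtain ⟨B, hB, hBr⟩ := Nat.sSup_mem
      (s := {t : ℕ | ∃ A : Matrix (Fin p) (Fin p) ℝ, Contains μ A ∧ A.rank = t})
      ⟨_, Matrix.of A, hA, rfl⟩ ⟨p, hle⟩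
    rw [Mrk, ← hBr]
    refine lt_of_le_of_ne (hle _ ⟨B, hB, rfl⟩) fun hrank => ?_
    have hli : LinearIndependent ℝ B.row := by
      rw [linearIndependent_iff_card_eq_finrank_span, Set.finrank,
        ← Matrix.rank_eq_finrank_span_row, hrank, Fintype.card_fin]
    have hu := (Matrix.isUnit_iff_isUnit_det B).1 (Matrix.linearIndependent_rows_iff_isUnit.1 hli)
    exact hu.ne_zero (h B hB)

theorem det_pinned_full {p : ℕ} (μ : Matrix (Fin p) (Fin p) (Set ℝ)) (r c : Fin p → Fin p)
    (hr : Function.Injective r) (hc : Function.Injective c) : (pinned μ r c).det ≠ 0 := by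
  have hr' := Finite.surjective_of_injective hr
  rw [← abs_ne_zero, ← abs_detc_compl μ r c hr hc, abs_ne_zero]
  have : IsEmpty {i : Fin p // ∀ t, r t ≠ i} := ⟨fun i => (hr' i.1).elim i.2⟩
  have : IsEmpty {j : Fin p // ∀ t, c t ≠ j} :=
    ⟨fun j => (Finite.surjective_of_injective hc j.1).elim j.2⟩
  rw [detc_eq_det _ (by simp), Matrix.det_eq_one_of_card_eq_zero (by simp)]
  exact one_ne_zero

end IntervalMatrix

open IntervalMatrix

/-- **Maximal-rank criterion for square general closed interval matrices.**
`Mrk(μ) < p` iff (1) `μ` has no totally nonconstant partial generalized diagonal of length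
`p`, and (2) the complementary matrix of every totally nonconstant partial generalized
diagonal of length between `0` and `p - 1` has `det^c = 0`.  A pg-diagonal of length `k` is
encoded by injective maps `r c : Fin k → Fin p` picking its rows and columns; its
complementary matrix is the submatrix on the remaining rows and columns. -/
theorem Mrk_lt_iff (p : ℕ) (μ : Matrix (Fin p) (Fin p) (Set ℝ)) (hμ : GCIM μ) :
    Mrk μ < p ↔
      ((¬ ∃ r c : Fin p → Fin p, Function.Injective r ∧ Function.Injective c ∧
          ∀ t, ¬ IsConst (μ (r t) (c t))) ∧
       (∀ k : ℕ, k < p → ∀ r c : Fin k → Fin p,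
          Function.Injective r → Function.Injective c →
          (∀ t, ¬ IsConst (μ (r t) (c t))) →
          detc (Matrix.of fun (i : {i : Fin p // ∀ t, r t ≠ i})
              (j : {j : Fin p // ∀ t, c t ≠ j}) => μ i.1 j.1) = 0)) := by
  rw [Mrk_lt_iff_det μ hμ, ← det_generic_eq_zero_iff μ hμ, det_generic_eq_zero_iff_pinned]
  constructor
  · intro h
    refine ⟨?_, fun k hk r c hr hc hrc => ?_⟩
    · rintro ⟨r, c, hr, hc, hrc⟩
      exact det_pinned_full μ r c hr hc (h p le_rfl r c hr hc hrc)
    · rw [← abs_eq_zero, abs_detc_compl μ r c hr hc, h k hk.le r c hr hc hrc, abs_zero]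
  · rintro ⟨hfull, h⟩ k hk r c hr hc hrc
    obtain rfl | hk := hk.eq_or_lt
    · exact (hfull ⟨r, c, hr, hc, hrc⟩).elim
    · rw [← abs_eq_zero, ← abs_detc_compl μ r c hr hc, h k hk r c hr hc hrc, abs_zero]
end

section
/- Let μ be a general closed interval matrix. Then Mrk(μ) equals the maximum of the natural numbers t such that there is a t×t submatrix of μ which has either a totally nonconstant partial generalized diagonal of length t, or a totally nonconstant partial generalized diagonal of length between 0 and t−1 whose complementary matrix has det^c ≠ 0. -/
open scoped Classical

open scoped Matrix

section Rank

variable {m n K : Type*} [Fintype n] [Field K]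

theorem Matrix.exists_linearIndependent_rows [Fintype m] (A : Matrix m n K) :
    ∃ r : Fin A.rank → m, Function.Injective r ∧
      LinearIndependent K (A.submatrix r id).row := by
  obtain ⟨κ, a, ha, hspan, hli⟩ := exists_linearIndependent' K A.row
  have : Finite κ := Finite.of_injective a ha
  have := Fintype.ofFinite κ
  have hcard : Fintype.card κ = A.rank := by
    rw [A.rank_eq_finrank_span_row, ← hspan]
    exact linearIndependent_iff_card_eq_finrank_span.mp hli
  let e : Fin A.rank ≃ κ := (Fintype.equivFinOfCardEq hcard).symm
  exact ⟨a ∘ e, ha.comp e.injective, hli.comp e e.injective⟩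

theorem Matrix.exists_submatrix_det_ne_zero [Fintype m] (A : Matrix m n K) :
    ∃ (r : Fin A.rank → m) (c : Fin A.rank → n),
      Function.Injective r ∧ Function.Injective c ∧ (A.submatrix r c).det ≠ 0 := by
  obtain ⟨r, hr, hli⟩ := A.exists_linearIndependent_rows
  have hrank : (A.submatrix r id)ᵀ.rank = A.rank := by
    rw [Matrix.rank_transpose, hli.rank_matrix, Fintype.card_fin]
  obtain ⟨c, hc, hli'⟩ := (A.submatrix r id)ᵀ.exists_linearIndependent_rows
  refine ⟨r, c ∘ Fin.cast hrank.symm, hr, hc.comp (Fin.cast_injective _), ?_⟩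
  have h : LinearIndependent K ((A.submatrix r (c ∘ Fin.cast hrank.symm))ᵀ).row :=
    hli'.comp _ (Fin.cast_injective hrank.symm)
  rw [Matrix.linearIndependent_rows_iff_isUnit, Matrix.isUnit_iff_isUnit_det,
    Matrix.det_transpose] at h
  exact h.ne_zero

theorem Matrix.le_rank_of_submatrix_det_ne_zero {t : ℕ} (A : Matrix m n K) (r : Fin t → m)
    (c : Fin t → n) (h : (A.submatrix r c).det ≠ 0) : t ≤ A.rank := by
  have hu : IsUnit (A.submatrix r c) :=
    (Matrix.isUnit_iff_isUnit_det _).mpr (isUnit_iff_ne_zero.mpr h)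
  have := A.rank_submatrix_le r c
  rwa [Matrix.rank_of_isUnit _ hu, Fintype.card_fin] at this

end Rank

section Sign

open Equiv

theorem sign_trans_trans_eq_mul {I J F : Type*} [Fintype I] [Fintype F] [DecidableEq F]
    (f : F ≃ I) (g : J ≃ F) (e e₀ : I ≃ J) :
    Perm.sign (f.trans (e.trans g)) =
      Perm.sign (f.trans (e₀.trans g)) * Perm.sign (e.trans e₀.symm) := by
  have h : f.trans (e.trans g) =
      ((f.trans (e.trans e₀.symm)).trans f.symm).trans (f.trans (e₀.trans g)) := by
    ext; simp
  rw [h, Perm.sign_trans]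
  exact congrArg _ (Perm.sign_symm_trans_trans (e.trans e₀.symm) f.symm)

theorem sign_subtypeCongr_eq_mul {α : Type*} [Fintype α] [DecidableEq α] {p q : α → Prop}
    [DecidablePred p] [DecidablePred q] (e e₀ : {x // p x} ≃ {x // q x})
    (g : {x // ¬p x} ≃ {x // ¬q x}) :
    Perm.sign (subtypeCongr e g) =
      Perm.sign (subtypeCongr e₀ g) * Perm.sign (e.trans e₀.symm) := by
  have h : subtypeCongr e g =
      (Perm.subtypeCongr (e.trans e₀.symm) (Equiv.refl {x // ¬p x})).trans
        (subtypeCongr e₀ g) := by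
    ext x
    by_cases hx : p x <;> simp [subtypeCongr, hx]
  rw [h, Perm.sign_trans, Perm.sign_subtypeCongr]
  simp

end Sign

theorem IsConst.eq_sSup {S : Set ℝ} (h : IsConst S) {x : ℝ} (hx : x ∈ S) : x = sSup S := by
  obtain ⟨a, rfl⟩ := h
  simpa using hx

theorem IsConst.sSup_mem {S : Set ℝ} (h : IsConst S) : sSup S ∈ S := by
  obtain ⟨a, rfl⟩ := h
  simp

theorem infinite_of_not_isConst {S : Set ℝ} (hne : S.Nonempty) (hS : IsPreconnected S)
    (h : ¬ IsConst S) : S.Infinite := by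
  refine hS.infinite_of_nontrivial (Set.not_subsingleton_iff.mp fun hs => h ?_)
  obtain ⟨a, ha⟩ := hne
  exact ⟨a, hs.eq_singleton_of_mem ha⟩

theorem GCIM.exists_contains {I J : Type*} {μ : Matrix I J (Set ℝ)} (hμ : GCIM μ) :
    ∃ A : Matrix I J ℝ, Contains μ A := by
  choose A hA using fun i j => (hμ i j).2.1
  exact ⟨A, hA⟩

/-- The matrix of polynomials with the constant entries of `ν` kept and every other entry
replaced by its own indeterminate. -/
noncomputable def genericMatrix {I J : Type*} (ν : Matrix I J (Set ℝ)) :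
    Matrix I J (MvPolynomial (I × J) ℝ) :=
  Matrix.of fun i j =>
    if IsConst (ν i j) then MvPolynomial.C (sSup (ν i j)) else MvPolynomial.X (i, j)

section Generic

open MvPolynomial

variable {t : ℕ} (ν : Matrix (Fin t) (Fin t) (Set ℝ))

theorem eval_det_genericMatrix (x : Fin t × Fin t → ℝ) :
    eval x (genericMatrix ν).det =
      (Matrix.of fun i j => if IsConst (ν i j) then sSup (ν i j) else x (i, j)).det := by
  rw [RingHom.map_det]
  congr 1
  ext i j
  by_cases h : IsConst (ν i j) <;> simp [genericMatrix, h]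

theorem exists_contains_det_ne_zero_iff (hν : GCIM ν) :
    (∃ A, Contains ν A ∧ A.det ≠ 0) ↔ (genericMatrix ν).det ≠ 0 := by
  constructor
  · rintro ⟨A, hA, hdet⟩ h0
    apply hdet
    have h := eval_det_genericMatrix ν fun ij => A ij.1 ij.2
    rw [h0, map_zero] at h
    rw [h]
    congr 1
    ext i j
    by_cases hc : IsConst (ν i j)
    · simp [hc, hc.eq_sSup (hA i j)]
    · simp [hc]
  · intro h
    by_contra! hall
    refine h (funext_set
      (fun ij : Fin t × Fin t => if IsConst (ν ij.1 ij.2) then Set.univ else ν ij.1 ij.2)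
      (fun ij => ?_) fun x hx => ?_)
    · by_cases hc : IsConst (ν ij.1 ij.2)
      · simpa [hc] using Set.infinite_univ
      · simpa [hc] using infinite_of_not_isConst (hν _ _).2.1 (hν _ _).2.2 hc
    · rw [eval_det_genericMatrix, map_zero]
      refine hall _ fun i j => ?_
      by_cases hc : IsConst (ν i j)
      · simpa [hc] using hc.sSup_mem
      · simpa [hc] using hx (i, j) (Set.mem_univ _)

/-- The exponent of the monomial contributed by `σ` to the determinant of the generic matrix. -/
noncomputable def permExponent (σ : Equiv.Perm (Fin t)) : Fin t × Fin t →₀ ℕ :=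
  ∑ i, if IsConst (ν i (σ i)) then 0 else Finsupp.single (i, σ i) 1

theorem permExponent_apply (σ : Equiv.Perm (Fin t)) (i j : Fin t) :
    permExponent ν σ (i, j) = if σ i = j ∧ ¬ IsConst (ν i j) then 1 else 0 := by
  have h : ∀ i', (if IsConst (ν i' (σ i')) then 0 else Finsupp.single (i', σ i') 1 :
      Fin t × Fin t →₀ ℕ) (i, j) =
      if i' = i then (if σ i = j ∧ ¬ IsConst (ν i j) then 1 else 0) else 0 := by
    intro i'
    by_cases hi : i' = i
    · subst hi
      by_cases hj : σ i' = j
      · subst hj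
        by_cases hc : IsConst (ν i' (σ i')) <;> simp [hc]
      · by_cases hc : IsConst (ν i' (σ i')) <;> simp [hc, hj]
    · by_cases hc : IsConst (ν i' (σ i')) <;> simp [hc, hi]
  rw [permExponent, Finsupp.finsetSum_apply, Finset.sum_congr rfl fun i' _ => h i']
  simp

/-- The exponent of the monomial attached to a pg-diagonal. -/
noncomputable def diagExponent {k : ℕ} (r c : Fin k → Fin t) : Fin t × Fin t →₀ ℕ :=
  ∑ s, Finsupp.single (r s, c s) 1

theorem diagExponent_apply {k : ℕ} {r : Fin k → Fin t} (c : Fin k → Fin t)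
    (hr : Function.Injective r) (i j : Fin t) :
    diagExponent r c (i, j) = if ∃ s, r s = i ∧ c s = j then 1 else 0 := by
  rw [diagExponent, Finsupp.finsetSum_apply]
  simp only [Finsupp.single_apply, Prod.mk.injEq]
  split_ifs with h
  · obtain ⟨s, rfl, rfl⟩ := h
    rw [Finset.sum_eq_single s] <;> simp +contextual [hr.eq_iff]
  · push Not at h
    exact Finset.sum_eq_zero fun s _ => if_neg fun hs => h s hs.1 hs.2

theorem permExponent_eq_diagExponent_iff {k : ℕ} {r c : Fin k → Fin t}
    (hr : Function.Injective r) (hn : ∀ s, ¬ IsConst (ν (r s) (c s)))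
    (σ : Equiv.Perm (Fin t)) :
    permExponent ν σ = diagExponent r c ↔
      (∀ s, σ (r s) = c s) ∧ ∀ i, (∀ s, r s ≠ i) → IsConst (ν i (σ i)) := by
  constructor
  · intro h
    refine ⟨fun s => ?_, fun i hi => ?_⟩
    · have := DFunLike.congr_fun h (r s, c s)
      rw [permExponent_apply, diagExponent_apply c hr,
        if_pos (⟨s, rfl, rfl⟩ : ∃ s', r s' = r s ∧ c s' = c s)] at this
      by_contra hne
      simp only [hne, false_and, if_false, zero_ne_one] at this
    · have := DFunLike.congr_fun h (i, σ i)
      rw [permExponent_apply, diagExponent_apply c hr,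
        if_neg (fun ⟨s, hs, _⟩ => hi s hs : ¬ ∃ s, r s = i ∧ c s = σ i)] at this
      by_contra hc
      simp only [hc, not_false_eq_true, and_self, if_true, one_ne_zero] at this
  · rintro ⟨h₁, h₂⟩
    ext ⟨i, j⟩
    rw [permExponent_apply, diagExponent_apply c hr]
    refine if_congr ⟨?_, ?_⟩ rfl rfl
    · rintro ⟨rfl, hc⟩
      by_contra! hne
      exact hc (h₂ i fun s hs => hne s hs (by rw [← hs, h₁]))
    · rintro ⟨s, rfl, rfl⟩
      exact ⟨h₁ s, hn s⟩

/-- The coefficient of the monomial contributed by `σ` to the determinant of the generic matrix. -/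
noncomputable def permCoeff (σ : Equiv.Perm (Fin t)) : ℝ :=
  ((Equiv.Perm.sign σ : ℤ) : ℝ) *
    ∏ i, if IsConst (ν i (σ i)) then sSup (ν i (σ i)) else 1

theorem det_genericMatrix :
    (genericMatrix ν).det = ∑ σ, monomial (permExponent ν σ) (permCoeff ν σ) := by
  rw [← Matrix.det_transpose, Matrix.det_apply']
  refine Finset.sum_congr rfl fun σ _ => ?_
  have h : ∀ i, (genericMatrix ν)ᵀ (σ i) i =
      monomial (if IsConst (ν i (σ i)) then 0 else Finsupp.single (i, σ i) 1)
        (if IsConst (ν i (σ i)) then sSup (ν i (σ i)) else 1) := by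
    intro i
    by_cases hc : IsConst (ν i (σ i)) <;>
      simp only [genericMatrix, Matrix.transpose_apply, Matrix.of_apply, hc, if_true, if_false] <;>
      rfl
  rw [Finset.prod_congr rfl fun i _ => h i, ← monomial_sum_prod, permExponent, permCoeff,
    ← C_mul_monomial]
  simp

theorem coeff_det_genericMatrix (d : Fin t × Fin t →₀ ℕ) :
    coeff d (genericMatrix ν).det = ∑ σ, if permExponent ν σ = d then permCoeff ν σ else 0 := by
  simp [det_genericMatrix, coeff_sum, coeff_monomial]

/-- The bijection between the rows and the columns met by a pg-diagonal. -/
noncomputable def diagEquiv {k : ℕ} {r c : Fin k → Fin t} (hr : Function.Injective r)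
    (hc : Function.Injective c) :
    {i : Fin t // ¬ ∀ s, r s ≠ i} ≃ {j : Fin t // ¬ ∀ s, c s ≠ j} :=
  (Equiv.ofBijective (fun s => (⟨r s, fun h => h s rfl⟩ : {i : Fin t // ¬ ∀ s, r s ≠ i}))
    ⟨fun a b h => hr (congrArg Subtype.val h), fun ⟨i, hi⟩ => by
      push Not at hi
      obtain ⟨s, rfl⟩ := hi
      exact ⟨s, rfl⟩⟩).symm.trans
  (Equiv.ofBijective (fun s => (⟨c s, fun h => h s rfl⟩ : {j : Fin t // ¬ ∀ s, c s ≠ j}))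
    ⟨fun a b h => hc (congrArg Subtype.val h), fun ⟨i, hi⟩ => by
      push Not at hi
      obtain ⟨s, rfl⟩ := hi
      exact ⟨s, rfl⟩⟩)

theorem diagEquiv_apply {k : ℕ} {r c : Fin k → Fin t} (hr : Function.Injective r)
    (hc : Function.Injective c) (s : Fin k) (h : ¬ ∀ s', r s' ≠ r s) :
    (diagEquiv hr hc ⟨r s, h⟩ : Fin t) = c s := by
  refine congrArg c ?_
  rw [Equiv.symm_apply_eq]
  rfl

/-- The indices avoided by `r`. -/
abbrev RangeCompl {k : ℕ} (r : Fin k → Fin t) : Type := {i : Fin t // ∀ s, r s ≠ i}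

/-- Up to sign, the coefficient attached to a totally nonconstant pg-diagonal in the determinant
of the generic matrix is the `detc` of the complementary matrix. -/
theorem coeff_diagExponent_det_genericMatrix {k : ℕ} {r c : Fin k → Fin t}
    (hr : Function.Injective r) (hc : Function.Injective c)
    (hn : ∀ s, ¬ IsConst (ν (r s) (c s))) :
    ∃ δ : ℤˣ, coeff (diagExponent r c) (genericMatrix ν).det =
      ((δ : ℤ) : ℝ) * detc (Matrix.of fun (i : {i : Fin t // ∀ s, r s ≠ i})
        (j : {j : Fin t // ∀ s, c s ≠ j}) => ν i.1 j.1) := by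
  let extend (e : RangeCompl r ≃ RangeCompl c) : Equiv.Perm (Fin t) :=
    Equiv.subtypeCongr e (diagEquiv hr hc)
  have extend_left (e : RangeCompl r ≃ RangeCompl c) (i : RangeCompl r) : extend e i.1 = (e i).1 := by
    simp [extend, Equiv.subtypeCongr]
  have extend_right (e : RangeCompl r ≃ RangeCompl c) (s : Fin k) : extend e (r s) = c s := by
    have h : ¬ ∀ s', r s' ≠ r s := fun h => h s rfl
    have : extend e (r s) = (diagEquiv hr hc ⟨r s, h⟩ : Fin t) := by
      simp [extend, Equiv.subtypeCongr]
    rw [this, diagEquiv_apply]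
  obtain ⟨δ, hδ⟩ : ∃ δ : ℤˣ, ∀ e : RangeCompl r ≃ RangeCompl c, Equiv.Perm.sign (extend e) =
      δ * Equiv.Perm.sign ((monoEquivOfFin (RangeCompl r) rfl).toEquiv.trans
        (e.trans (monoEquivOfFin (RangeCompl c) (Fintype.card_congr e.symm)).toEquiv.symm)) := by
    rcases isEmpty_or_nonempty (RangeCompl r ≃ RangeCompl c) with h | ⟨⟨e₀⟩⟩
    · exact ⟨1, fun e => h.elim e⟩
    · refine ⟨Equiv.Perm.sign (extend e₀) *
        (Equiv.Perm.sign ((monoEquivOfFin (RangeCompl r) rfl).toEquiv.trans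
        (e₀.trans (monoEquivOfFin (RangeCompl c) (Fintype.card_congr e₀.symm)).toEquiv.symm)))⁻¹,
        fun e => ?_⟩
      rw [sign_trans_trans_eq_mul (monoEquivOfFin (RangeCompl r) rfl).toEquiv
        (monoEquivOfFin (RangeCompl c) (Fintype.card_congr e.symm)).toEquiv.symm e e₀]
      simp only [extend]
      rw [sign_subtypeCongr_eq_mul e e₀, mul_assoc, inv_mul_cancel_left]
      congr!
  refine ⟨δ, ?_⟩
  rw [coeff_det_genericMatrix, detc, Finset.mul_sum]
  symm
  refine Finset.sum_of_injOn extend (fun e _ e' _ h => ?_) (by simp)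
    (fun σ _ hσ => if_neg fun h => hσ ?_) fun e _ => ?_
  · ext i
    rw [← extend_left, ← extend_left, h]
  · rw [permExponent_eq_diagExponent_iff ν hr hn] at h
    have key : ∀ i, (∀ s, r s ≠ i) ↔ ∀ s, c s ≠ σ i := fun i =>
      forall_congr' fun s => by rw [← h.1 s, σ.injective.ne_iff]
    refine ⟨σ.subtypeEquiv key, by simp, ?_⟩
    ext1 i
    by_cases hi : ∀ s, r s ≠ i
    · exact extend_left _ ⟨i, hi⟩
    · push Not at hi
      obtain ⟨s, rfl⟩ := hi
      rw [extend_right, h.1]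
  · have hiff : permExponent ν (extend e) = diagExponent r c ↔
        ∀ i : RangeCompl r, IsConst (ν i.1 (e i).1) := by
      rw [permExponent_eq_diagExponent_iff ν hr hn]
      simp only [extend_right, implies_true, true_and]
      exact ⟨fun h i => extend_left e i ▸ h i.1 i.2, fun h i hi => extend_left e ⟨i, hi⟩ ▸ h ⟨i, hi⟩⟩
    by_cases hconst : ∀ i : RangeCompl r, IsConst (ν i.1 (e i).1)
    · refine (congrArg _ (if_pos hconst)).trans
        (Eq.trans ?_ (if_pos (hiff.mpr hconst)).symm)
      rw [permCoeff, hδ, ← Fintype.prod_subtype_mul_prod_subtype (fun i => ∀ s, r s ≠ i)]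
      have h₁ : ∀ i : RangeCompl r,
          (if IsConst (ν i.1 (extend e i.1)) then sSup (ν i.1 (extend e i.1)) else 1) =
          sSup (ν i.1 (e i).1) := fun i => by
        rw [extend_left, if_pos (hconst i)]
      have h₂ : ∀ i : {i : Fin t // ¬ ∀ s, r s ≠ i},
          (if IsConst (ν i.1 (extend e i.1)) then sSup (ν i.1 (extend e i.1)) else 1) = 1 := by
        rintro ⟨i, hi⟩
        push Not at hi
        obtain ⟨s, rfl⟩ := hi
        exact if_neg (by rw [extend_right]; exact hn s)
      rw [Finset.prod_congr rfl fun i _ => h₁ i, Finset.prod_congr rfl fun i _ => h₂ i]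
      push_cast
      rw [Finset.prod_const_one, mul_one, mul_assoc]
      rfl
    · exact (congrArg _ (if_neg hconst)).trans
        ((mul_zero _).trans (if_neg (hiff.not.mpr hconst)).symm)

theorem detc_ne_zero_of_isEmpty {I J : Type*} [Fintype I] [Fintype J] [LinearOrder I]
    [LinearOrder J] [IsEmpty I] [IsEmpty J] (ν : Matrix I J (Set ℝ)) : detc ν ≠ 0 := by
  rw [detc, Fintype.sum_subsingleton _ (Equiv.equivOfIsEmpty I J)]
  simp

theorem det_genericMatrix_ne_zero_of_detc_ne_zero {k : ℕ} {r c : Fin k → Fin t}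
    (hr : Function.Injective r) (hc : Function.Injective c)
    (hn : ∀ s, ¬ IsConst (ν (r s) (c s)))
    (h : detc (Matrix.of fun (i : {i : Fin t // ∀ s, r s ≠ i})
        (j : {j : Fin t // ∀ s, c s ≠ j}) => ν i.1 j.1) ≠ 0) :
    (genericMatrix ν).det ≠ 0 := by
  obtain ⟨δ, hδ⟩ := coeff_diagExponent_det_genericMatrix ν hr hc hn
  intro h0
  rw [h0, coeff_zero, eq_comm, mul_eq_zero] at hδ
  exact hδ.elim (by exact_mod_cast δ.ne_zero) h

theorem exists_diag_of_det_genericMatrix_ne_zero (h : (genericMatrix ν).det ≠ 0) :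
    ∃ k, k ≤ t ∧ ∃ r c : Fin k → Fin t, Function.Injective r ∧ Function.Injective c ∧
      (∀ s, ¬ IsConst (ν (r s) (c s))) ∧
      detc (Matrix.of fun (i : {i : Fin t // ∀ s, r s ≠ i})
        (j : {j : Fin t // ∀ s, c s ≠ j}) => ν i.1 j.1) ≠ 0 := by
  obtain ⟨d, hd⟩ := ne_zero_iff.mp h
  obtain ⟨σ, -, hσ⟩ := Finset.exists_ne_zero_of_sum_ne_zero (coeff_det_genericMatrix ν d ▸ hd)
  have hσd : permExponent ν σ = d := by
    by_contra hne
    exact hσ (if_neg hne)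
  let S : Finset (Fin t) := Finset.univ.filter fun i => ¬ IsConst (ν i (σ i))
  let r : Fin S.card → Fin t := S.orderEmbOfFin rfl
  have hr : Function.Injective r := (S.orderEmbOfFin rfl).injective
  have hn : ∀ s, ¬ IsConst (ν (r s) (σ (r s))) := fun s =>
    (Finset.mem_filter.mp (S.orderEmbOfFin_mem rfl s)).2
  have hdiag : permExponent ν σ = diagExponent r (σ ∘ r) := by
    refine (permExponent_eq_diagExponent_iff ν (c := σ ∘ r) hr hn σ).mpr ?_
    refine ⟨fun _ => rfl, fun i hi => ?_⟩
    by_contra hc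
    have : i ∈ Set.range r := by
      rw [Finset.range_orderEmbOfFin]
      simpa [S] using hc
    obtain ⟨s, hs⟩ := this
    exact hi s hs
  obtain ⟨δ, hδ⟩ := coeff_diagExponent_det_genericMatrix ν hr (σ.injective.comp hr) hn
  refine ⟨S.card, by simpa using S.card_le_univ, r, σ ∘ r, hr, σ.injective.comp hr, hn,
    fun h0 => hd ?_⟩
  rw [← hσd, hdiag, hδ, h0, mul_zero]

/-- A square interval matrix contains a nonsingular matrix iff it has a totally nonconstant
pg-diagonal that is complete or has a complementary matrix with nonzero `detc`. -/
theorem exists_contains_det_ne_zero_iff_exists_diag (hν : GCIM ν) :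
    (∃ A, Contains ν A ∧ A.det ≠ 0) ↔
      ((∃ r c : Fin t → Fin t, Function.Injective r ∧ Function.Injective c ∧
          ∀ s, ¬ IsConst (ν (r s) (c s))) ∨
        (∃ k : ℕ, k < t ∧ ∃ r c : Fin k → Fin t,
          Function.Injective r ∧ Function.Injective c ∧
          (∀ s, ¬ IsConst (ν (r s) (c s))) ∧
          detc (Matrix.of fun (i : {i : Fin t // ∀ s, r s ≠ i})
            (j : {j : Fin t // ∀ s, c s ≠ j}) => ν i.1 j.1) ≠ 0)) := by
  rw [exists_contains_det_ne_zero_iff ν hν]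
  constructor
  · intro h
    obtain ⟨k, hk, r, c, hr, hc, hn, hdet⟩ := exists_diag_of_det_genericMatrix_ne_zero ν h
    rcases hk.eq_or_lt with rfl | hk
    · exact Or.inl ⟨r, c, hr, hc, hn⟩
    · exact Or.inr ⟨k, hk, r, c, hr, hc, hn, hdet⟩
  · rintro (⟨r, c, hr, hc, hn⟩ | ⟨k, -, r, c, hr, hc, hn, hdet⟩)
    · have isEmpty_compl {f : Fin t → Fin t} (hf : Function.Injective f) :
          IsEmpty {i : Fin t // ∀ s, f s ≠ i} :=
        ⟨fun i => (Finite.surjective_of_injective hf i.1).elim i.2⟩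
      have := isEmpty_compl hr
      have := isEmpty_compl hc
      exact det_genericMatrix_ne_zero_of_detc_ne_zero ν hr hc hn (detc_ne_zero_of_isEmpty _)
    · exact det_genericMatrix_ne_zero_of_detc_ne_zero ν hr hc hn hdet

end Generic

theorem GCIM.exists_contains_submatrix_eq {I J I' J' : Type*} {μ : Matrix I J (Set ℝ)}
    (hμ : GCIM μ) {r : I' → I} {c : J' → J} (hr : Function.Injective r)
    (hc : Function.Injective c) {B : Matrix I' J' ℝ} (hB : Contains (μ.submatrix r c) B) :
    ∃ A, Contains μ A ∧ A.submatrix r c = B := by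
  have h (i : I) (j : J) : ∃ x ∈ μ i j, ∀ i' j', r i' = i → c j' = j → x = B i' j' := by
    by_cases hij : ∃ i' j', r i' = i ∧ c j' = j
    · obtain ⟨i', j', rfl, rfl⟩ := hij
      refine ⟨B i' j', hB i' j', fun a b ha hb => ?_⟩
      rw [hr ha, hc hb]
    · obtain ⟨x, hx⟩ := (hμ i j).2.1
      exact ⟨x, hx, fun i' j' hi hj => (hij ⟨i', j', hi, hj⟩).elim⟩
  choose A hA hAB using h
  exact ⟨A, hA, Matrix.ext fun i' j' => hAB _ _ i' j' rfl rfl⟩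

/-- The maximal rank is the maximal size of a square submatrix containing a nonsingular matrix. -/
theorem Mrk_eq_sSup_det_ne_zero (p q : ℕ) (μ : Matrix (Fin p) (Fin q) (Set ℝ)) (hμ : GCIM μ) :
    Mrk μ = sSup {t : ℕ | ∃ (ri : Fin t → Fin p) (ci : Fin t → Fin q),
      Function.Injective ri ∧ Function.Injective ci ∧
      ∃ B, Contains (μ.submatrix ri ci) B ∧ B.det ≠ 0} := by
  have hne : {t : ℕ | ∃ A : Matrix (Fin p) (Fin q) ℝ, Contains μ A ∧ A.rank = t}.Nonempty :=
    let ⟨A, hA⟩ := hμ.exists_contains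
    ⟨_, A, hA, rfl⟩
  refine le_antisymm (csSup_le_csSup ⟨p, ?_⟩ hne ?_) (csSup_le ⟨0, ?_⟩ ?_)
  · rintro t ⟨ri, -, hri, -⟩
    simpa using Fintype.card_le_of_injective ri hri
  · rintro _ ⟨A, hA, rfl⟩
    obtain ⟨r, c, hr, hc, hdet⟩ := A.exists_submatrix_det_ne_zero
    exact ⟨r, c, hr, hc, _, fun i j => hA _ _, hdet⟩
  · exact ⟨Fin.elim0, Fin.elim0, fun i => i.elim0, fun i => i.elim0, 0, fun i => i.elim0, by simp⟩
  · rintro t ⟨ri, ci, hri, hci, B, hB, hdet⟩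
    obtain ⟨A, hA, rfl⟩ := hμ.exists_contains_submatrix_eq hri hci hB
    refine (A.le_rank_of_submatrix_det_ne_zero ri ci hdet).trans
      (le_csSup ⟨p, ?_⟩ ⟨A, hA, rfl⟩)
    rintro _ ⟨A', -, rfl⟩
    simpa using A'.rank_le_card_height

/-- **Formula for the maximal rank of a general closed interval matrix.**
`Mrk(μ)` is the maximum of the natural numbers `t` such that `μ` has a `t × t` submatrix
(given by injective row and column selections `ri`, `ci`) which has either a totally
nonconstant pg-diagonal of length `t`, or a totally nonconstant pg-diagonal of length
`k` with `0 ≤ k ≤ t - 1` whose complementary matrix has `det^c ≠ 0`. -/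
theorem Mrk_eq_sSup (p q : ℕ) (μ : Matrix (Fin p) (Fin q) (Set ℝ)) (hμ : GCIM μ) :
    Mrk μ = sSup {t : ℕ |
      ∃ (ri : Fin t → Fin p) (ci : Fin t → Fin q),
        Function.Injective ri ∧ Function.Injective ci ∧
        ((∃ r c : Fin t → Fin t, Function.Injective r ∧ Function.Injective c ∧
            ∀ s, ¬ IsConst (μ.submatrix ri ci (r s) (c s))) ∨
         (∃ k : ℕ, k < t ∧ ∃ r c : Fin k → Fin t,
            Function.Injective r ∧ Function.Injective c ∧
            (∀ s, ¬ IsConst (μ.submatrix ri ci (r s) (c s))) ∧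
            detc (Matrix.of fun (i : {i : Fin t // ∀ s, r s ≠ i})
                (j : {j : Fin t // ∀ s, c s ≠ j}) =>
              μ.submatrix ri ci i.1 j.1) ≠ 0))} := by
  rw [Mrk_eq_sSup_det_ne_zero p q μ hμ]
  congr! 8 with t ri ci
  refine and_congr_right fun _ => ?_
  exact exists_contains_det_ne_zero_iff_exists_diag (μ.submatrix ri ci) fun i j => hμ _ _
end

section
/- Let p(x₁, …, xₙ) be a polynomial with real coefficients of degree at most 1 in every variable, and let x̄ ∈ ℝⁿ. Then p(x) ≥ 0 for every x ∈ x̄ + ℝⁿ_{≥0} if and only if p(x̄) ≥ 0 and (∂p/∂xᵢ)(x) ≥ 0 for every x ∈ x̄ + ℝⁿ_{≥0} and for every i = 1, …, n. The analogous equivalence holds with strict inequality for p: p(x) > 0 for every x ∈ x̄ + ℝⁿ_{≥0} if and only if p(x̄) > 0 and (∂p/∂xᵢ)(x) ≥ 0 for every x ∈ x̄ + ℝⁿ_{≥0} and every i. -/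
open MvPolynomial in
/-- A polynomial of degree at most one in `X i` is affine along the `i`-th coordinate line. -/
theorem MvPolynomial.eval_update_of_degreeOf_le_one {σ R : Type*} [DecidableEq σ] [CommRing R]
    {P : MvPolynomial σ R} {i : σ} (hP : P.degreeOf i ≤ 1) (x : σ → R) (t : R) :
    eval (Function.update x i t) P = eval x P + (t - x i) * eval x (pderiv i P) := by
  have monomial_case : ∀ (m : σ →₀ ℕ) (c : R), m i ≤ 1 →
      eval (Function.update x i t) (monomial m c) =
        eval x (monomial m c) + (t - x i) * eval x (pderiv i (monomial m c)) := by
    intro m c hm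
    obtain ⟨d, k, hd, hk, rfl⟩ : ∃ (d : σ →₀ ℕ) (k : ℕ), d i = 0 ∧ k ≤ 1 ∧
        m = d + Finsupp.single i k :=
      ⟨m.erase i, m i, Finsupp.erase_same, hm, (Finsupp.erase_add_single i m).symm⟩
    have eval_eq : eval (Function.update x i t) (monomial d c) = eval x (monomial d c) := by
      simp only [eval_monomial, Finsupp.prod]
      congr 1
      refine Finset.prod_congr rfl fun j hj => ?_
      rw [Function.update_of_ne]
      rintro rfl
      exact Finsupp.mem_support_iff.1 hj hd
    have pderiv_eq : pderiv i (monomial d c) = 0 := by simp [pderiv_monomial, hd]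
    rw [monomial_add_single, pderiv_mul, pderiv_eq]
    interval_cases k
    · simp [eval_eq]
    · simp only [pow_one, map_mul, eval_X, eval_eq, Function.update_self, pderiv_X_self, zero_mul,
        zero_add, mul_one]
      ring
  rw [P.as_sum]
  simp only [map_sum, Finset.mul_sum, ← Finset.sum_add_distrib]
  exact Finset.sum_congr rfl fun m hm => monomial_case m _ ((monomial_le_degreeOf i hm).trans hP)

open MvPolynomial in
theorem MvPolynomial.eval_pderiv_nonneg_of_forall_eval_nonneg {σ : Type*} {P : MvPolynomial σ ℝ}
    {i : σ} (hP : P.degreeOf i ≤ 1) {a : σ → ℝ} (h : ∀ x, a ≤ x → 0 ≤ eval x P)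
    {x : σ → ℝ} (hx : a ≤ x) : 0 ≤ eval x (pderiv i P) := by
  classical
  by_contra! hneg
  set s := (eval x P + 1) / -eval x (pderiv i P)
  have s_nonneg : 0 ≤ s := div_nonneg (by linarith [h x hx]) (by linarith)
  have key := h (Function.update x i (x i + s))
    (hx.trans (le_update_self_iff.2 (by linarith)))
  rw [eval_update_of_degreeOf_le_one hP] at key
  have s_mul : s * -eval x (pderiv i P) = eval x P + 1 := div_mul_cancel₀ _ (by linarith)
  linarith

open MvPolynomial in
theorem MvPolynomial.eval_le_eval_of_forall_eval_pderiv_nonneg {σ : Type*} [Fintype σ]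
    {P : MvPolynomial σ ℝ} (hP : ∀ i, P.degreeOf i ≤ 1) {a : σ → ℝ}
    (h : ∀ x, a ≤ x → ∀ i, 0 ≤ eval x (pderiv i P)) {x : σ → ℝ} (hx : a ≤ x) :
    eval a P ≤ eval x P := by
  classical
  suffices ∀ s : Finset σ, eval a P ≤ eval (s.piecewise x a) P by
    simpa using this Finset.univ
  intro s
  induction s using Finset.induction_on with
  | empty => simp
  | insert i s hi ih =>
    rw [Finset.piecewise_insert, eval_update_of_degreeOf_le_one (hP i),
      Finset.piecewise_eq_of_notMem _ _ _ hi]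
    have := mul_nonneg (sub_nonneg.2 (hx i))
      (h (s.piecewise x a) (s.le_piecewise_of_le_of_le hx le_rfl) i)
    linarith


/-- **Sign of a multiaffine polynomial on an upper orthant.**
Let `P ∈ ℝ[x₁,…,xₙ]` have degree at most `1` in every variable and let `x̄ ∈ ℝⁿ`.
Then `P ≥ 0` on `x̄ + ℝⁿ₊` iff `P(x̄) ≥ 0` and all formal partial derivatives `∂P/∂xᵢ`
are `≥ 0` on `x̄ + ℝⁿ₊`; and `P > 0` on `x̄ + ℝⁿ₊` iff `P(x̄) > 0` and all formal partial
derivatives are `≥ 0` on `x̄ + ℝⁿ₊`. -/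
theorem multiaffine_nonneg_on_orthant_iff (n : ℕ) (P : MvPolynomial (Fin n) ℝ)
    (hdeg : ∀ i, P.degreeOf i ≤ 1) (xbar : Fin n → ℝ) :
    ((∀ x : Fin n → ℝ, (∀ i, xbar i ≤ x i) → 0 ≤ MvPolynomial.eval x P) ↔
      (0 ≤ MvPolynomial.eval xbar P ∧
       ∀ x : Fin n → ℝ, (∀ i, xbar i ≤ x i) →
         ∀ i, 0 ≤ MvPolynomial.eval x (MvPolynomial.pderiv i P))) ∧
    ((∀ x : Fin n → ℝ, (∀ i, xbar i ≤ x i) → 0 < MvPolynomial.eval x P) ↔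
      (0 < MvPolynomial.eval xbar P ∧
       ∀ x : Fin n → ℝ, (∀ i, xbar i ≤ x i) →
         ∀ i, 0 ≤ MvPolynomial.eval x (MvPolynomial.pderiv i P))) := by
  have pderiv_nonneg := fun h : ∀ x : Fin n → ℝ, xbar ≤ x → 0 ≤ MvPolynomial.eval x P =>
    fun x (hx : xbar ≤ x) i =>
      MvPolynomial.eval_pderiv_nonneg_of_forall_eval_nonneg (hdeg i) h hx
  refine ⟨⟨fun h => ⟨h xbar fun _ => le_rfl, pderiv_nonneg h⟩, fun ⟨h₀, h⟩ x hx => ?_⟩,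
    ⟨fun h => ⟨h xbar fun _ => le_rfl, pderiv_nonneg fun x hx => (h x hx).le⟩,
      fun ⟨h₀, h⟩ x hx => ?_⟩⟩
  · exact h₀.trans (MvPolynomial.eval_le_eval_of_forall_eval_pderiv_nonneg hdeg h hx)
  · exact h₀.trans_le (MvPolynomial.eval_le_eval_of_forall_eval_pderiv_nonneg hdeg h hx)
end

section
/- Let ν be a p×p general closed interval matrix all of whose entries are bounded or half-bounded (i.e., no entry equals (−∞, +∞)). Then ν is full-rank if and only if, for every vertex matrix γ of ν of even type, γ is full-rank and det(γ̄) has the same sign as det(ν̄_l), i.e., det(γ̄)·det(ν̄_l) > 0. -/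
open scoped Classical

/-- A bounded entry: a closed bounded interval `[a, b]` with `a ≤ b`. -/
def IsBddEntry (S : Set ℝ) : Prop := ∃ a b : ℝ, a ≤ b ∧ S = Set.Icc a b

/-- A left-bounded entry `[a, +∞)`. -/
def IsLeftB (S : Set ℝ) : Prop := ∃ a : ℝ, S = Set.Ici a

/-- A right-bounded entry `(-∞, a]`. -/
def IsRightB (S : Set ℝ) : Prop := ∃ a : ℝ, S = Set.Iic a

/-- The real number associated to an entry which is a singleton, a bounded interval, or a
half-bounded interval: the left endpoint if the entry is bounded below (so `[a,b] ↦ a`,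
`{a} ↦ a`, `[a,+∞) ↦ a`) and otherwise the right endpoint (`(-∞,b] ↦ b`).
Applied entrywise to a matrix `ν` with bounded or half-bounded entries this realizes
`ν̄ₗ`; applied to a matrix `γ` with constant or half-bounded entries it realizes `γ̄`. -/
noncomputable def pick (S : Set ℝ) : ℝ := if BddBelow S then sInf S else sSup S

/-- `γ` is a vertex matrix of `ν`: on bounded entries of `ν`, `γ` is the singleton of one
of the two endpoints; on all other entries `γ` coincides with `ν`. -/
def IsVertex {I J : Type*} (ν γ : Matrix I J (Set ℝ)) : Prop :=
  ∀ i j, (IsBddEntry (ν i j) → (γ i j = {sInf (ν i j)} ∨ γ i j = {sSup (ν i j)})) ∧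
         (¬ IsBddEntry (ν i j) → γ i j = ν i j)

/-- A vertex matrix `γ` of `ν` is of even type: for every `2 × 2` submatrix of `ν` all of
whose entries are bounded intervals, either some of its entries is constant, or the number
of the corresponding entries of `γ` equal to the left endpoint of the corresponding entry
of `ν` is even. -/
def EvenTypeG {I J : Type*} (ν γ : Matrix I J (Set ℝ)) : Prop :=
  ∀ i1 i2 j1 j2, i1 ≠ i2 → j1 ≠ j2 →
    (IsBddEntry (ν i1 j1) ∧ IsBddEntry (ν i1 j2) ∧ IsBddEntry (ν i2 j1) ∧
      IsBddEntry (ν i2 j2)) →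
    ((IsConst (ν i1 j1) ∨ IsConst (ν i1 j2) ∨ IsConst (ν i2 j1) ∨ IsConst (ν i2 j2)) ∨
     Even ((if γ i1 j1 = {sInf (ν i1 j1)} then 1 else 0) +
           (if γ i1 j2 = {sInf (ν i1 j2)} then 1 else 0) +
           (if γ i2 j1 = {sInf (ν i2 j1)} then 1 else 0) +
           (if γ i2 j2 = {sInf (ν i2 j2)} then (1 : ℕ) else 0)))

/-- The chosen endpoint of a bounded or half-bounded entry belongs to the entry. -/
theorem pick_mem {S : Set ℝ} (hS : IsBddEntry S ∨ IsLeftB S ∨ IsRightB S) : pick S ∈ S := by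
  unfold pick
  rcases hS with ⟨a, b, hab, rfl⟩ | ⟨a, rfl⟩ | ⟨a, rfl⟩
  · simp [bddBelow_Icc, csInf_Icc hab, hab]
  · simp [bddBelow_Ici, csInf_Ici]
  · simp [not_bddBelow_Iic, csSup_Iic]

/-- In a full-rank matrix of intervals, all contained matrices have determinants of the same
sign. -/
theorem Contains.det_mul_det_pos {n : Type*} [Fintype n] [DecidableEq n]
    {μ : Matrix n n (Set ℝ)} (hμ : ∀ i j, Convex ℝ (μ i j))
    (hfull : ∀ A : Matrix n n ℝ, Contains μ A → A.det ≠ 0) {B C : Matrix n n ℝ}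
    (hB : Contains μ B) (hC : Contains μ C) : 0 < B.det * C.det := by
  have hconv : Convex ℝ {A : Matrix n n ℝ | Contains μ A} :=
    fun X hX Y hY a b ha hb hab i j => hμ i j (hX i j) (hY i j) ha hb hab
  have hcont : ContinuousOn (fun A : Matrix n n ℝ => A.det) {A | Contains μ A} :=
    (continuous_id.matrix_det).continuousOn
  have hzero : ∀ X Y : Matrix n n ℝ, Contains μ X → Contains μ Y →
      X.det ≤ 0 → 0 ≤ Y.det → False := by
    intro X Y hX hY h1 h2
    obtain ⟨Z, hZ, hZ0⟩ := hconv.isPreconnected.intermediate_value hX hY hcont ⟨h1, h2⟩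
    exact hfull Z hZ hZ0
  rcases le_total B.det 0 with h1 | h1 <;> rcases le_total C.det 0 with h2 | h2
  · exact mul_pos_of_neg_of_neg (h1.lt_of_ne (hfull B hB)) (h2.lt_of_ne (hfull C hC))
  · exact (hzero B C hB hC h1 h2).elim
  · exact (hzero C B hC hB h2 h1).elim
  · exact mul_pos (h1.lt_of_ne' (hfull B hB)) (h2.lt_of_ne' (hfull C hC))

/-- If the determinants of all matrices whose `i`-th row is one of `P i`, `Q i` have a common
sign, then so does the determinant of every matrix whose `i`-th row lies in the segment
between `P i` and `Q i`. -/
theorem Matrix.det_pos_of_rows_mem_segment {n : Type*} [Fintype n] [DecidableEq n]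
    {P Q : Matrix n n ℝ} {d : ℝ}
    (h : ∀ M : Matrix n n ℝ, (∀ i, M i = P i ∨ M i = Q i) → 0 < M.det * d)
    {M : Matrix n n ℝ} (hM : ∀ i, M i ∈ segment ℝ (P i) (Q i)) : 0 < M.det * d := by
  suffices H : ∀ (s : Finset n) (M : Matrix n n ℝ), (∀ i ∈ s, M i ∈ segment ℝ (P i) (Q i)) →
      (∀ i ∉ s, M i = P i ∨ M i = Q i) → 0 < M.det * d from
    H Finset.univ M (fun i _ => hM i) (fun i hi => (hi (Finset.mem_univ i)).elim)
  intro s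
  induction s using Finset.induction_on with
  | empty => exact fun M _ hM => h M fun i => hM i (Finset.notMem_empty i)
  | insert k s hk ih =>
    intro M hseg hvert
    have key : ∀ v, v = P k ∨ v = Q k → 0 < (M.updateRow k v).det * d := by
      intro v hv
      refine ih _ (fun i hi => ?_) (fun i hi => ?_)
      · rw [Matrix.updateRow_ne (ne_of_mem_of_not_mem hi hk)]
        exact hseg i (Finset.mem_insert_of_mem hi)
      · rcases eq_or_ne i k with rfl | hik
        · simpa [Matrix.updateRow_self] using hv
        · rw [Matrix.updateRow_ne hik]
          exact hvert i (by simp [hik, hi])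
    obtain ⟨a, b, ha, hb, hab, hMk⟩ := hseg k (Finset.mem_insert_self k s)
    have hdet : M.det = a * (M.updateRow k (P k)).det + b * (M.updateRow k (Q k)).det := by
      conv_lhs => rw [← M.updateRow_eq_self k, ← hMk]
      rw [Matrix.det_updateRow_add, Matrix.det_updateRow_smul, Matrix.det_updateRow_smul]
    have h1 := key _ (Or.inl rfl)
    have h2 := key _ (Or.inr rfl)
    rw [hdet, show (a * (M.updateRow k (P k)).det + b * (M.updateRow k (Q k)).det) * d =
      a * ((M.updateRow k (P k)).det * d) + b * ((M.updateRow k (Q k)).det * d) by ring]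
    rcases ha.eq_or_lt with rfl | ha
    · obtain rfl : b = 1 := by linarith
      simpa using h2
    · exact add_pos_of_pos_of_nonneg (mul_pos ha h1) (mul_nonneg hb h2.le)

/-- A segment whose endpoints have pairings of opposite weak signs with `x` contains a vector
orthogonal to `x`. -/
theorem exists_mem_segment_dotProduct_eq_zero {n : Type*} [Fintype n] {u v x : n → ℝ}
    (hu : 0 ≤ u ⬝ᵥ x) (hv : v ⬝ᵥ x ≤ 0) : ∃ w ∈ segment ℝ u v, w ⬝ᵥ x = 0 := by
  have hcont : ContinuousOn (fun w : n → ℝ => w ⬝ᵥ x) (segment ℝ u v) := by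
    unfold dotProduct
    fun_prop
  obtain ⟨w, hw, hw0⟩ := (convex_segment u v).isPreconnected.intermediate_value
    (right_mem_segment ℝ u v) (left_mem_segment ℝ u v) hcont ⟨hv, hu⟩
  exact ⟨w, hw, hw0⟩

/-- The real matrix which agrees with `A` on the unbounded entries of `ν`, and whose bounded
entry `(i, j)` is the left endpoint iff exactly one of `c i`, `e j` is true. -/
noncomputable def signedVertex {I J : Type*} (ν : Matrix I J (Set ℝ)) (A : Matrix I J ℝ)
    (c : I → Bool) (e : J → Bool) : Matrix I J ℝ :=
  Matrix.of fun i j =>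
    if IsBddEntry (ν i j) then if c i = e j then sSup (ν i j) else sInf (ν i j) else A i j

/-- The vertex matrix of `ν` whose bounded entries are those of `signedVertex ν A c e`. -/
noncomputable def signedVertexSet {I J : Type*} (ν : Matrix I J (Set ℝ))
    (c : I → Bool) (e : J → Bool) : Matrix I J (Set ℝ) :=
  Matrix.of fun i j =>
    if IsBddEntry (ν i j) then {if c i = e j then sSup (ν i j) else sInf (ν i j)} else ν i j

theorem isVertex_signedVertexSet {I J : Type*} (ν : Matrix I J (Set ℝ))
    (c : I → Bool) (e : J → Bool) : IsVertex ν (signedVertexSet ν c e) := by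
  intro i j
  refine ⟨fun h => ?_, fun h => by simp [signedVertexSet, h]⟩
  by_cases hc : c i = e j <;> simp [signedVertexSet, h, hc]

theorem contains_signedVertexSet {I J : Type*} {ν : Matrix I J (Set ℝ)} {A : Matrix I J ℝ}
    (hA : Contains ν A) (c : I → Bool) (e : J → Bool) :
    Contains (signedVertexSet ν c e) (signedVertex ν A c e) := by
  intro i j
  by_cases h : IsBddEntry (ν i j)
  · simp [signedVertexSet, signedVertex, h]
  · simpa [signedVertexSet, signedVertex, h] using hA i j

theorem signedVertexSet_eq_singleton_sInf_iff {I J : Type*} {ν : Matrix I J (Set ℝ)}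
    (c : I → Bool) (e : J → Bool) {i : I} {j : J} (hb : IsBddEntry (ν i j))
    (hc : ¬ IsConst (ν i j)) : signedVertexSet ν c e i j = {sInf (ν i j)} ↔ c i ≠ e j := by
  have hne : sSup (ν i j) ≠ sInf (ν i j) := by
    obtain ⟨a, b, hab, hS⟩ := hb
    rw [hS, csSup_Icc hab, csInf_Icc hab]
    rintro rfl
    exact hc ⟨b, by rw [hS, Set.Icc_self]⟩
  by_cases h : c i = e j <;> simp [signedVertexSet, hb, h, hne]

theorem evenTypeG_signedVertexSet {I J : Type*} (ν : Matrix I J (Set ℝ))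
    (c : I → Bool) (e : J → Bool) : EvenTypeG ν (signedVertexSet ν c e) := by
  rintro i₁ i₂ j₁ j₂ - - ⟨h₁, h₂, h₃, h₄⟩
  refine or_iff_not_imp_left.2 fun hconst => ?_
  simp only [not_or] at hconst
  obtain ⟨c₁, c₂, c₃, c₄⟩ := hconst
  simp only [signedVertexSet_eq_singleton_sInf_iff c e h₁ c₁,
    signedVertexSet_eq_singleton_sInf_iff c e h₂ c₂,
    signedVertexSet_eq_singleton_sInf_iff c e h₃ c₃,
    signedVertexSet_eq_singleton_sInf_iff c e h₄ c₄]
  cases c i₁ <;> cases c i₂ <;> cases e j₁ <;> cases e j₂ <;> decide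

/-- Entries of a vertex matrix of a matrix with bounded or half-bounded entries are bounded or
half-bounded, and contained in the corresponding entries. -/
theorem IsVertex.entry {I J : Type*} {ν γ : Matrix I J (Set ℝ)} (hγ : IsVertex ν γ)
    (hb : ∀ i j, IsBddEntry (ν i j) ∨ IsLeftB (ν i j) ∨ IsRightB (ν i j)) (i : I) (j : J) :
    (IsBddEntry (γ i j) ∨ IsLeftB (γ i j) ∨ IsRightB (γ i j)) ∧ γ i j ⊆ ν i j := by
  by_cases h : IsBddEntry (ν i j)
  · have hs : ∀ a : ℝ, IsBddEntry {a} := fun a => ⟨a, a, le_rfl, (Set.Icc_self a).symm⟩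
    obtain ⟨a, b, hab, hS⟩ := id h
    rcases (hγ i j).1 h with h' | h' <;> rw [h'] <;> refine ⟨Or.inl (hs _), ?_⟩ <;>
      simp [hS, csInf_Icc hab, csSup_Icc hab, hab]
  · rw [(hγ i j).2 h]
    exact ⟨hb i j, subset_rfl⟩

theorem convex_of_bounded_or_halfBounded {S : Set ℝ}
    (hS : IsBddEntry S ∨ IsLeftB S ∨ IsRightB S) : Convex ℝ S := by
  rcases hS with ⟨a, b, -, rfl⟩ | ⟨a, rfl⟩ | ⟨a, rfl⟩
  · exact convex_Icc a b
  · exact convex_Ici a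
  · exact convex_Iic a

/-- **Full rank via vertex matrices of even type.** Let `ν` be a `p × p` general closed
interval matrix all of whose entries are bounded or half-bounded.  Then `ν` is full-rank
iff every vertex matrix `γ` of `ν` of even type is full-rank and `det γ̄` has the same
sign as `det ν̄ₗ`, i.e. `det γ̄ · det ν̄ₗ > 0`. -/
theorem fullRank_iff_vertex (p : ℕ) (ν : Matrix (Fin p) (Fin p) (Set ℝ)) (hν : GCIM ν)
    (hb : ∀ i j, IsBddEntry (ν i j) ∨ IsLeftB (ν i j) ∨ IsRightB (ν i j)) :
    (∀ A : Matrix (Fin p) (Fin p) ℝ, Contains ν A → A.det ≠ 0) ↔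
    (∀ γ : Matrix (Fin p) (Fin p) (Set ℝ), IsVertex ν γ → EvenTypeG ν γ →
      ((∀ A : Matrix (Fin p) (Fin p) ℝ, Contains γ A → A.det ≠ 0) ∧
       0 < (Matrix.of fun i j => pick (γ i j)).det *
           (Matrix.of fun i j => pick (ν i j)).det)) := by
  constructor
  · intro hfull γ hγ _
    have hsub : ∀ A, Contains γ A → Contains ν A :=
      fun A hA i j => (hγ.entry hb i j).2 (hA i j)
    refine ⟨fun A hA => hfull A (hsub A hA), ?_⟩
    exact Contains.det_mul_det_pos (fun i j => convex_of_bounded_or_halfBounded (hb i j)) hfull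
      (hsub _ fun i j => pick_mem (hγ.entry hb i j).1) (fun i j => pick_mem (hb i j))
  · intro hvert A hA hdet
    obtain ⟨x, hx, hAx⟩ := Matrix.exists_mulVec_eq_zero_iff.2 hdet
    set d := (Matrix.of fun i j => pick (ν i j)).det
    let e : Fin p → Bool := fun j => decide (0 ≤ x j)
    have hpos : ∀ c : Fin p → Bool, 0 < (signedVertex ν A c e).det * d := by
      intro c
      have hγ := isVertex_signedVertexSet ν c e
      obtain ⟨hfull, hd⟩ := hvert _ hγ (evenTypeG_signedVertexSet ν c e)
      have hBC := Contains.det_mul_det_pos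
        (C := Matrix.of fun i j => pick (signedVertexSet ν c e i j))
        (fun i j => convex_of_bounded_or_halfBounded (hγ.entry hb i j).1) hfull
        (contains_signedVertexSet hA c e) (fun i j => pick_mem (hγ.entry hb i j).1)
      refine pos_of_mul_pos_left ((mul_pos hBC hd).trans_eq ?_)
        (sq_nonneg (Matrix.of fun i j => pick (signedVertexSet ν c e i j)).det)
      ring
    have hrow : ∀ i, A i ⬝ᵥ x = 0 := fun i => congrFun hAx i
    have hbd : ∀ i j, IsBddEntry (ν i j) → sInf (ν i j) ≤ A i j ∧ A i j ≤ sSup (ν i j) := by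
      rintro i j ⟨a, b, -, hS⟩
      have hAij := hA i j
      rw [hS] at hAij ⊢
      exact ⟨csInf_le bddBelow_Icc hAij, le_csSup bddAbove_Icc hAij⟩
    have hP : ∀ i, 0 ≤ signedVertex ν A (fun _ => true) e i ⬝ᵥ x := by
      intro i
      rw [← hrow i]
      refine Finset.sum_le_sum fun j _ => ?_
      by_cases h : IsBddEntry (ν i j)
      · obtain ⟨hlo, hhi⟩ := hbd i j h
        by_cases hxj : 0 ≤ x j
        · simpa [signedVertex, h, e, hxj] using
            mul_le_mul_of_nonneg_right hhi hxj
        · simpa [signedVertex, h, e, hxj] using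
            mul_le_mul_of_nonpos_right hlo (not_le.1 hxj).le
      · simp [signedVertex, h]
    have hQ : ∀ i, signedVertex ν A (fun _ => false) e i ⬝ᵥ x ≤ 0 := by
      intro i
      rw [← hrow i]
      refine Finset.sum_le_sum fun j _ => ?_
      by_cases h : IsBddEntry (ν i j)
      · obtain ⟨hlo, hhi⟩ := hbd i j h
        by_cases hxj : 0 ≤ x j
        · simpa [signedVertex, h, e, hxj, not_lt.2 hxj] using
            mul_le_mul_of_nonneg_right hlo hxj
        · simpa only [signedVertex, Matrix.of_apply, h, e, hxj, decide_false, if_true] using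
            mul_le_mul_of_nonpos_right hhi (not_le.1 hxj).le
      · simp [signedVertex, h]
    choose M hM hMx using fun i => exists_mem_segment_dotProduct_eq_zero (hP i) (hQ i)
    have hMdet : (Matrix.of M).det = 0 :=
      Matrix.exists_mulVec_eq_zero_iff.1 ⟨x, hx, funext hMx⟩
    have hlt : 0 < (Matrix.of M).det * d := by
      refine Matrix.det_pos_of_rows_mem_segment (fun N hN => ?_) hM
      have hc : ∀ i, ∃ b : Bool, N i = signedVertex ν A (fun _ => b) e i := fun i =>
        (hN i).elim (fun h => ⟨true, h⟩) (fun h => ⟨false, h⟩)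
      choose c hc using hc
      have hNc : N = signedVertex ν A c e := by
        funext i
        rw [hc i]
        rfl
      rw [hNc]
      exact hpos c
    simp [hMdet] at hlt
end
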